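/- arXiv:math/0406355 — 7 statements merged into one kernel-verified Lean document; each statement's English description precedes it below -/
import Mathlib

section
/- In the ring of polynomials with rational coefficients in variables T, Y, Z, the identity ∑_{r=0}^{k} ∑_{n=0}^{r} C(2k+1-r, n)·C(k-n, r-n)·(T^{k-r}/(2k+1-r))·(T-Y)^n·(Y-Z)^{2k+1-r-n}·Y^r·Z^r = ∑_{s=0}^{k} (-1)^s·C(k, s)·(T^{k-s}/(2k+1-s))·(Y^{2k+1}·Z^s − Z^{2k+1}·Y^s) holds for every natural number k. -/
open MvPolynomial

namespace Aux3

open Finset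

variable {R : Type*} [CommRing R]

/-- inner binomial sum -/
def h (y w : R) (n j l : ℕ) : R :=
  ∑ pq ∈ antidiagonal j, (Nat.choose j pq.1 : R) *
    (y ^ pq.1 * w ^ pq.2 * (Nat.choose (n + (pq.1 + 2 * pq.2) + l) n : R))

/-- outer sum -/
def S (x y w : R) (k l : ℕ) : R :=
  ∑ nj ∈ antidiagonal k, x ^ nj.1 * h y w nj.1 nj.2 l

lemma h_pascal (y w : R) (n j l : ℕ) :
    h y w (n + 1) j (l + 1) = h y w n j (l + 1) + h y w (n + 1) j l := by
  unfold h
  rw [← sum_add_distrib]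
  refine sum_congr rfl fun pq _ => ?_
  have e : n + 1 + (pq.1 + 2 * pq.2) + (l + 1) = (n + (pq.1 + 2 * pq.2) + (l + 1)) + 1 := by ring
  have e2 : n + 1 + (pq.1 + 2 * pq.2) + l = n + (pq.1 + 2 * pq.2) + (l + 1) := by ring
  rw [e, e2, Nat.choose_succ_succ]
  push_cast
  ring

lemma h_zero (y w : R) (j l l' : ℕ) : h y w 0 j l = h y w 0 j l' := by
  unfold h
  simp

lemma h_succ (y w : R) (n j l : ℕ) :
    h y w n (j + 1) l = y * h y w n j (l + 1) + w * h y w n j (l + 2) := by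
  unfold h
  have := Finset.sum_antidiagonal_choose_succ_mul (R := R)
    (fun p q => y ^ p * w ^ q * (Nat.choose (n + (p + 2 * q) + l) n : R)) j
  rw [this, mul_sum, mul_sum, add_comm]
  congr 1
  · refine sum_congr rfl fun pq hpq => ?_
    have hs : pq.1 + pq.2 = j := by simpa using hpq
    rw [show n + (pq.1 + 1 + 2 * pq.2) + l = n + (pq.1 + 2 * pq.2) + (l + 1) by ring]
    rw [show j.choose pq.2 = j.choose pq.1 from (Nat.choose_symm_of_eq_add (by omega))]
    ring
  · refine sum_congr rfl fun pq hpq => ?_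
    rw [show n + (pq.1 + 2 * (pq.2 + 1)) + l = n + (pq.1 + 2 * pq.2) + (l + 2) by ring]
    ring

lemma S_pascal (x y w : R) (k l : ℕ) :
    S x y w (k + 1) (l + 1) = x * S x y w k (l + 1) + S x y w (k + 1) l := by
  unfold S
  rw [Finset.Nat.sum_antidiagonal_succ, Finset.Nat.sum_antidiagonal_succ, mul_sum]
  simp only [h_pascal]
  rw [h_zero y w (k + 1) (l + 1) l]
  simp only [mul_add, sum_add_distrib, pow_succ']
  simp only [mul_assoc]
  ring

lemma S_zero (x y w : R) (l : ℕ) : S x y w 0 l = 1 := by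
  simp [S, h]

lemma S_succ (x y w : R) (k : ℕ) :
    S x y w (k + 1) 0 = x ^ (k + 1) + y * S x y w k 1 + w * S x y w k 2 := by
  unfold S
  rw [Finset.Nat.sum_antidiagonal_succ', mul_sum, mul_sum]
  simp only [h_succ]
  rw [add_assoc, ← sum_add_distrib]
  congr 1
  · simp [h]
  · refine sum_congr rfl fun pq _ => ?_
    ring

lemma S_rec (x y w : R) (k : ℕ) :
    S x y w (k + 1) 0 = (x + y) * S x y w k 0 + w * S x y w k 1 := by
  cases k with
  | zero => rw [S_succ]; simp only [S_zero]; ring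
  | succ k =>
    rw [S_succ, S_pascal x y w k 1, S_pascal x y w k 0]
    have h1 := S_succ x y w k
    have h2 := S_pascal x y w k 0
    linear_combination (-x) * h1 - w * h2 + w * (S_pascal x y w k 0) 

lemma key (T a b : R) (k : ℕ) :
    S ((a * T - 1) * b) (b - a) (T * (b - a) ^ 2) (k + 1) 0
      + (a * T - 1) * (b - a) * S ((a * T - 1) * b) (b - a) (T * (b - a) ^ 2) k 1
      = (b * (T * b - 1)) ^ (k + 1) := by
  induction k with
  | zero => rw [S_rec]; simp only [S_zero]; ring
  | succ k ih =>
    rw [S_rec, S_pascal _ _ _ k 0, pow_succ (b * (T * b - 1)), ← ih, S_rec]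
    ring

open Polynomial in
/-- polynomial form of the left side -/
noncomputable def P (t a : ℚ) (k : ℕ) : ℚ[X] :=
  ∑ nj ∈ antidiagonal k, ∑ pq ∈ antidiagonal nj.2,
    Polynomial.C ((Nat.choose (nj.1 + (pq.1 + 2 * pq.2) + 1) nj.1 : ℚ) * (Nat.choose nj.2 pq.1 : ℚ)
      / ((nj.1 + (pq.1 + 2 * pq.2) + 1 : ℕ) : ℚ) * t ^ pq.2 * (a * t - 1) ^ nj.1) *
      (Polynomial.X ^ nj.1 * (Polynomial.X - Polynomial.C a) ^ (pq.1 + 2 * pq.2 + 1))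

open Polynomial in
/-- polynomial form of the right side -/
noncomputable def Q (t a : ℚ) (k : ℕ) : ℚ[X] :=
  ∑ s ∈ range (k + 1),
    Polynomial.C ((-1 : ℚ) ^ s * (Nat.choose k s : ℚ) / ((2 * k + 1 - s : ℕ) : ℚ) * t ^ (k - s)) *
      (Polynomial.X ^ (2 * k + 1 - s) - Polynomial.C (a ^ (2 * k + 1 - s)))

lemma Q_der (t a : ℚ) (k : ℕ) : Polynomial.derivative (Q t a k) =
    (Polynomial.X * (Polynomial.C t * Polynomial.X - 1)) ^ k := by
  unfold Q
  rw [mul_pow, sub_eq_add_neg, add_comm (Polynomial.C t * Polynomial.X), add_pow, mul_sum,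
    Polynomial.derivative_sum]
  refine sum_congr rfl fun s hs => ?_
  have hs' : s ≤ k := by simpa [Nat.lt_succ_iff] using hs
  obtain ⟨m, rfl⟩ := Nat.exists_eq_add_of_le hs'
  have e : 2 * (s + m) + 1 - s = (s + m + m) + 1 := by omega
  rw [e, Nat.add_sub_cancel_left]
  rw [Polynomial.derivative_C_mul, Polynomial.derivative_sub, Polynomial.derivative_C,
    Polynomial.derivative_X_pow, sub_zero, Nat.add_sub_cancel, ← mul_assoc,
    ← Polynomial.C_mul]
  have hne : ((s + m + m + 1 : ℕ) : ℚ) ≠ 0 := by positivity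
  rw [show (-1 : ℚ) ^ s * ((s + m).choose s : ℚ) / ((s + m + m + 1 : ℕ) : ℚ) * t ^ m
    * ((s + m + m + 1 : ℕ) : ℚ) = (-1 : ℚ) ^ s * ((s + m).choose s : ℚ) * t ^ m by field_simp]
  simp only [map_mul, map_pow, map_neg, map_one, map_natCast]
  ring

lemma coefA (n M : ℕ) : (Nat.choose (n + M + 1) n : ℚ) / ((n + M + 1 : ℕ) : ℚ) * ((M + 1 : ℕ) : ℚ)
    = (Nat.choose (n + M) n : ℚ) := by
  have hne : ((n + M + 1 : ℕ) : ℚ) ≠ 0 := by positivity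
  have := Nat.choose_mul_succ_eq (n + M) n
  rw [show n + M + 1 - n = M + 1 by omega] at this
  have h2 : ((n + M).choose n : ℚ) * ((n + M + 1 : ℕ) : ℚ)
    = ((n + M + 1).choose n : ℚ) * ((M + 1 : ℕ) : ℚ) := by exact_mod_cast this
  field_simp
  linarith

lemma coefB (n M : ℕ) : (Nat.choose (n + 1 + M + 1) (n + 1) : ℚ) / ((n + 1 + M + 1 : ℕ) : ℚ)
    * ((n + 1 : ℕ) : ℚ) = (Nat.choose (n + M + 1) n : ℚ) := by
  have hne : ((n + 1 + M + 1 : ℕ) : ℚ) ≠ 0 := by positivity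
  have := Nat.add_one_mul_choose_eq (n + M + 1) n
  rw [show n + M + 1 + 1 = n + 1 + M + 1 by ring] at this
  have h2 : ((n + 1 + M + 1 : ℕ) : ℚ) * ((n + M + 1).choose n : ℚ)
    = ((n + 1 + M + 1).choose (n + 1) : ℚ) * ((n + 1 : ℕ) : ℚ) := by exact_mod_cast this
  field_simp
  linarith

open Polynomial in
lemma P_der (t a : ℚ) (k : ℕ) : Polynomial.derivative (P t a k) =
    (Polynomial.X * (Polynomial.C t * Polynomial.X - 1)) ^ k := by
  have split : Polynomial.derivative (P t a k) =
      S ((Polynomial.C a * Polynomial.C t - 1) * Polynomial.X) (Polynomial.X - Polynomial.C a)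
        (Polynomial.C t * (Polynomial.X - Polynomial.C a) ^ 2) k 0 +
      ∑ nj ∈ antidiagonal k, ∑ pq ∈ antidiagonal nj.2,
        Polynomial.C ((Nat.choose (nj.1 + (pq.1 + 2 * pq.2) + 1) nj.1 : ℚ)
          / ((nj.1 + (pq.1 + 2 * pq.2) + 1 : ℕ) : ℚ) * (nj.1 : ℚ)) *
        ((Nat.choose nj.2 pq.1 : ℚ[X]) * Polynomial.C t ^ pq.2 *
          (Polynomial.C a * Polynomial.C t - 1) ^ nj.1 *
          (Polynomial.X ^ (nj.1 - 1) *
            (Polynomial.X - Polynomial.C a) ^ (pq.1 + 2 * pq.2 + 1))) := by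
    unfold P S h
    rw [Polynomial.derivative_sum, ← sum_add_distrib]
    refine sum_congr rfl fun nj _ => ?_
    rw [Polynomial.derivative_sum, mul_sum, ← sum_add_distrib]
    refine sum_congr rfl fun pq _ => ?_
    obtain ⟨n, j⟩ := nj
    obtain ⟨p, q⟩ := pq
    simp only
    have hA := congrArg Polynomial.C (coefA n (p + 2 * q))
    rw [Polynomial.derivative_C_mul, Polynomial.derivative_mul, Polynomial.derivative_X_pow,
      Polynomial.derivative_X_sub_C_pow, Nat.add_sub_cancel]
    rw [mul_div_right_comm]
    generalize (Nat.choose (n + (p + 2 * q) + 1) n : ℚ) / ((n + (p + 2 * q) + 1 : ℕ) : ℚ) = A at *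
    rw [add_zero, ← map_natCast (Polynomial.C) ((n + (p + 2 * q)).choose n), ← hA]
    simp only [map_mul, map_pow, map_sub, map_one, map_natCast]
    push_cast
    rw [mul_pow _ Polynomial.X, mul_pow _ (_ ^ 2)]
    generalize (Polynomial.X - Polynomial.C a : ℚ[X]) = d
    generalize (Polynomial.C a * Polynomial.C t - 1 : ℚ[X]) = c
    ring
  rw [split]
  cases k with
  | zero => simp [S_zero]
  | succ k =>
    rw [← key (Polynomial.C t) (Polynomial.C a) Polynomial.X k]
    congr 1
    rw [Finset.Nat.sum_antidiagonal_succ]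
    simp only [Nat.cast_zero, mul_zero, map_zero, zero_mul, sum_const_zero, zero_add]
    unfold S h
    rw [mul_sum]
    refine sum_congr rfl fun nj _ => ?_
    rw [mul_sum, mul_sum]
    refine sum_congr rfl fun pq _ => ?_
    rw [coefB, Nat.add_sub_cancel, map_natCast, mul_pow _ Polynomial.X, mul_pow _ (_ ^ 2)]
    generalize (Polynomial.X - Polynomial.C a : ℚ[X]) = d
    generalize (Polynomial.C a * Polynomial.C t - 1 : ℚ[X]) = c
    ring

lemma P_eq_Q (t a : ℚ) (k : ℕ) : P t a k = Q t a k := by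
  have hd : Polynomial.derivative (P t a k - Q t a k) = 0 := by
    rw [Polynomial.derivative_sub, P_der, Q_der, sub_self]
  have hc := Polynomial.eq_C_of_natDegree_eq_zero
    (Polynomial.derivative_eq_zero.mp hd)
  have he : (P t a k - Q t a k).eval a = 0 := by
    simp [P, Q, Polynomial.eval_finsetSum]
  rw [hc, Polynomial.eval_C] at he
  rw [he, map_zero] at hc
  exact sub_eq_zero.mp hc

lemma reindex {M : Type*} [AddCommMonoid M] (f : ℕ → ℕ → ℕ → ℕ → M) (k : ℕ) :
    ∑ r ∈ range (k + 1), ∑ n ∈ range (r + 1), f n (k - n) (r - n) (k - r) =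
    ∑ nj ∈ antidiagonal k, ∑ pq ∈ antidiagonal nj.2, f nj.1 nj.2 pq.1 pq.2 := by
  rw [sum_sigma', sum_sigma']
  refine sum_bij' (fun x _ => ⟨(x.2, k - x.2), (x.1 - x.2, k - x.1)⟩)
    (fun x _ => ⟨x.1.1 + x.2.1, x.1.1⟩) ?_ ?_ ?_ ?_ ?_
  · rintro ⟨r, n⟩ hx
    simp at hx ⊢
    omega
  · rintro ⟨⟨n, j⟩, ⟨p, q⟩⟩ hx
    simp at hx ⊢
    omega
  · rintro ⟨r, n⟩ hx
    simp at hx ⊢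
    omega
  · rintro ⟨⟨n, j⟩, ⟨p, q⟩⟩ hx
    simp at hx
    obtain ⟨h1, h2⟩ := hx
    have e1 : k - n = j := by omega
    have e2 : n + p - n = p := by omega
    have e3 : k - (n + p) = q := by omega
    simp [e1, e3]
  · rintro ⟨r, n⟩ hx
    rfl

lemma numeric (t y z : ℚ) (hy : y ≠ 0) (hz : z ≠ 0) (k : ℕ) :
    ∑ r ∈ range (k + 1), ∑ n ∈ range (r + 1),
        ((Nat.choose (2 * k + 1 - r) n : ℚ) * (Nat.choose (k - n) (r - n) : ℚ)
            / ((2 * k + 1 - r : ℕ) : ℚ)) *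
          t ^ (k - r) * (t - y) ^ n * (y - z) ^ (2 * k + 1 - r - n) * y ^ r * z ^ r =
      ∑ s ∈ range (k + 1),
        ((-1 : ℚ) ^ s * (Nat.choose k s : ℚ) / ((2 * k + 1 - s : ℕ) : ℚ)) *
          t ^ (k - s) * (y ^ (2 * k + 1) * z ^ s - z ^ (2 * k + 1) * y ^ s) := by
  have hPQ := congrArg (fun p => (y * z) ^ (2 * k + 1) * Polynomial.eval z⁻¹ p) (P_eq_Q t y⁻¹ k)
  convert hPQ using 1
  · unfold P
    simp only [Polynomial.eval_finsetSum, Polynomial.eval_mul, Polynomial.eval_C,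
      Polynomial.eval_pow, Polynomial.eval_sub, Polynomial.eval_X]
    rw [← reindex (fun n j p q => ((Nat.choose (n + (p + 2 * q) + 1) n : ℚ) * (Nat.choose j p : ℚ)
      / ((n + (p + 2 * q) + 1 : ℕ) : ℚ) * t ^ q * (y⁻¹ * t - 1) ^ n) *
      (z⁻¹ ^ n * (z⁻¹ - y⁻¹) ^ (p + 2 * q + 1))) k, mul_sum]
    refine sum_congr rfl fun r hr => ?_
    rw [mul_sum]
    refine sum_congr rfl fun n hn => ?_
    rw [mem_range, Nat.lt_succ_iff] at hr hn
    obtain ⟨p, rfl⟩ := Nat.exists_eq_add_of_le hn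
    obtain ⟨q, rfl⟩ := Nat.exists_eq_add_of_le hr
    have e1 : 2 * (n + p + q) + 1 - (n + p) = n + (p + 2 * q) + 1 := by omega
    have e2 : n + (p + 2 * q) + 1 - n = p + 2 * q + 1 := by omega
    rw [e1, e2, Nat.add_sub_cancel_left, Nat.add_sub_cancel_left]
    have h1 : y⁻¹ * t - 1 = (t - y) / y := by field_simp
    have h2 : z⁻¹ - y⁻¹ = (y - z) / (y * z) := by field_simp
    rw [h1, h2, div_pow, div_pow, inv_pow,
      show 2 * (n + p + q) + 1 = (p + 2 * q + 1) + (n + p) + n by ring,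
      pow_add (y * z) (p + 2 * q + 1 + (n + p)), pow_add (y * z) (p + 2 * q + 1),
      mul_pow y z n, mul_pow y z (n + p)]
    have hyz : (y * z) ^ (p + 2 * q + 1) ≠ 0 := pow_ne_zero _ (mul_ne_zero hy hz)
    have hyn : y ^ n ≠ 0 := pow_ne_zero _ hy
    have hzn : z ^ n ≠ 0 := pow_ne_zero _ hz
    generalize (y * z) ^ (p + 2 * q + 1) = A at *
    generalize ((n + (p + 2 * q) + 1).choose n : ℚ) * (((n + p + q - n).choose p : ℕ) : ℚ) /
      ((n + (p + 2 * q) + 1 : ℕ) : ℚ) = B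
    generalize y ^ (n + p) = D
    generalize z ^ (n + p) = E
    generalize y ^ n = F at *
    generalize z ^ n = G at *
    field_simp
  · unfold Q
    simp only [Polynomial.eval_finsetSum, Polynomial.eval_mul, Polynomial.eval_C,
      Polynomial.eval_pow, Polynomial.eval_sub, Polynomial.eval_X]
    rw [mul_sum]
    refine sum_congr rfl fun s hs => ?_
    rw [mem_range, Nat.lt_succ_iff] at hs
    obtain ⟨m, hm⟩ : ∃ m, 2 * k + 1 = m + s := ⟨2 * k + 1 - s, by omega⟩
    rw [hm, Nat.add_sub_cancel]
    have hyn : y ^ m ≠ 0 := pow_ne_zero _ hy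
    have hzn : z ^ m ≠ 0 := pow_ne_zero _ hz
    rw [mul_pow, pow_add, pow_add, inv_pow, inv_pow]
    generalize (-1 : ℚ) ^ s * (k.choose s : ℚ) / (m : ℚ) = B
    field_simp

end Aux3

theorem stmt_3 (k : ℕ) :
    let T : MvPolynomial (Fin 3) ℚ := X 0
    let Y : MvPolynomial (Fin 3) ℚ := X 1
    let Z : MvPolynomial (Fin 3) ℚ := X 2
    ∑ r ∈ Finset.range (k + 1), ∑ n ∈ Finset.range (r + 1),
        C ((Nat.choose (2 * k + 1 - r) n : ℚ) * (Nat.choose (k - n) (r - n) : ℚ)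
            / ((2 * k + 1 - r : ℕ) : ℚ)) *
          T ^ (k - r) * (T - Y) ^ n * (Y - Z) ^ (2 * k + 1 - r - n) * Y ^ r * Z ^ r =
      ∑ s ∈ Finset.range (k + 1),
        C ((-1 : ℚ) ^ s * (Nat.choose k s : ℚ) / ((2 * k + 1 - s : ℕ) : ℚ)) *
          T ^ (k - s) * (Y ^ (2 * k + 1) * Z ^ s - Z ^ (2 * k + 1) * Y ^ s) := by
  intro T Y Z
  have hYZ : Y * Z ≠ 0 := mul_ne_zero (X_ne_zero 1) (X_ne_zero 2)
  refine mul_left_cancel₀ hYZ (MvPolynomial.funext fun v => ?_)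
  rw [map_mul, map_mul (eval v) (Y * Z)]
  by_cases h0 : eval v (Y * Z) = 0
  · rw [h0, zero_mul, zero_mul]
  · have hYv : eval v Y = v 1 := eval_X 1
    have hZv : eval v Z = v 2 := eval_X 2
    have hTv : eval v T = v 0 := eval_X 0
    have hy : v 1 ≠ 0 := fun h => h0 (by rw [map_mul, hYv, h, zero_mul])
    have hz : v 2 ≠ 0 := fun h => h0 (by rw [map_mul, hZv, h, mul_zero])
    congr 1
    have := Aux3.numeric (v 0) (v 1) (v 2) hy hz k
    simp only [map_sum, map_mul, map_pow, map_sub, eval_C, hYv, hZv, hTv]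
    exact this
end

section
/- In the polynomial ring ℚ[T, X, Y, Z], for every natural number k: ∑_{r=0}^{k} ∑_{n=0}^{r} ((k+1)/(2k+1-r))·C(2k+1-r, n)·C(k-n, r-n)·T^{k-r}·[ X^{2k+1}(T-Y)^n(Y-Z)^{2k+1-r-n}Y^rZ^r + Y^{2k+1}(T-Z)^n(Z-X)^{2k+1-r-n}Z^rX^r + Z^{2k+1}(T-X)^n(X-Y)^{2k+1-r-n}X^rY^r ] = 0. -/
open MvPolynomial

/-- the coefficient -/
noncomputable def gco (k r n : ℕ) : ℝ :=
  ((k + 1 : ℕ) : ℝ) / ((2 * k + 1 - r : ℕ) : ℝ)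
            * (Nat.choose (2 * k + 1 - r) n : ℝ) * (Nat.choose (k - n) (r - n) : ℝ)

lemma gco_eq (n i j : ℕ) : gco (n + i + j) (n + i) n =
    ((n + i + j + 1 : ℕ) : ℝ) * ((n + i + 2 * j).factorial : ℝ) * ((i + j).factorial : ℝ) /
      ((n.factorial : ℝ) * ((i + 2 * j + 1).factorial : ℝ) * (j.factorial : ℝ)
        * (i.factorial : ℝ)) := by
  unfold gco
  have h1 : 2 * (n + i + j) + 1 - (n + i) = n + (i + 2 * j + 1) := by omega
  have h2 : n + i + j - n = i + j := by omega
  have h3 : n + i - n = i := by omega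
  rw [h1, h2, h3]
  have c1 := Nat.add_choose_mul_factorial_mul_factorial n (i + 2 * j + 1)
  rw [← Nat.choose_symm_add] at c1
  have c2 := Nat.add_choose_mul_factorial_mul_factorial i j
  rw [← Nat.choose_symm_add] at c2
  have h4 : n + (i + 2 * j + 1) = (n + i + 2 * j) + 1 := by omega
  rw [h4] at c1 ⊢
  rw [Nat.factorial_succ (n + i + 2 * j)] at c1
  have d1 : (((n + i + 2 * j + 1).choose n : ℕ) : ℝ) * n.factorial * (i + 2 * j + 1).factorial
     = (n + i + 2 * j + 1 : ℕ) * (n + i + 2 * j).factorial := by exact_mod_cast c1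
  have d2 : (((i + j).choose i : ℕ) : ℝ) * i.factorial * j.factorial
     = (i + j).factorial := by exact_mod_cast c2
  have e1 : (n.factorial : ℝ) ≠ 0 := by exact_mod_cast n.factorial_ne_zero
  have e2 : (i.factorial : ℝ) ≠ 0 := by exact_mod_cast i.factorial_ne_zero
  have e3 : (j.factorial : ℝ) ≠ 0 := by exact_mod_cast j.factorial_ne_zero
  have e4 : ((i + 2 * j + 1).factorial : ℝ) ≠ 0 := by
    exact_mod_cast (i + 2 * j + 1).factorial_ne_zero
  have e5 : ((n + i + 2 * j + 1 : ℕ) : ℝ) ≠ 0 := by positivity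
  rw [eq_div_iff (by positivity), div_mul_eq_mul_div, div_mul_eq_mul_div, div_mul_eq_mul_div,
    div_eq_iff e5, ← d2]
  linear_combination ((n + i + j + 1 : ℕ) : ℝ) * (((i + j).choose i : ℕ) : ℝ) * i.factorial *
    j.factorial * d1

noncomputable def S1 (k : ℕ) (T w d : ℝ) (r n : ℕ) : ℝ :=
  gco k r n * T ^ (k - r) * (n * (n + (2 * k + 1 - r - n : ℕ)) * T * w ^ (n - 1)
    * d ^ (2 * k + 1 - r - n))
noncomputable def S2 (k : ℕ) (T w d : ℝ) (r n : ℕ) : ℝ :=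
  gco k r n * T ^ (k - r) * (n * (2 * k + 1 - r - n : ℕ) * w ^ (n - 1)
    * d ^ (2 * k + 1 - r - n - 1))
noncomputable def S3 (k : ℕ) (T w d : ℝ) (r n : ℕ) : ℝ :=
  gco k r n * T ^ (k - r) * ((2 * k + 1 - r - n : ℕ) * (2 * k + 1 - r - n - 1 : ℕ) * w ^ n
    * d ^ (2 * k + 1 - r - n - 1 - 1))

lemma S3_last (k : ℕ) (T w d : ℝ) : S3 k T w d k k = 0 := by
  have : 2 * k + 1 - k - k - 1 = 0 := by omega
  simp [S3, this]

lemma S1_shift (k : ℕ) (T w d : ℝ) (r n : ℕ) (hr : r < k) (hn : n ≤ r) :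
    S1 k T w d (r + 1) (n + 1) = S3 k T w d r n * ((k - r : ℕ) / (k - n : ℕ)) := by
  obtain ⟨i, rfl⟩ := Nat.exists_eq_add_of_le hn
  obtain ⟨j, rfl⟩ := Nat.exists_eq_add_of_lt hr
  have g1 := gco_eq (n + 1) i j
  have g2 := gco_eq n i (j + 1)
  have a1 : n + 1 + i + j = n + i + j + 1 := by omega
  have a2 : n + 1 + i = n + i + 1 := by omega
  have a3 : n + i + (j + 1) = n + i + j + 1 := by omega
  rw [a1, a2] at g1
  rw [a3] at g2
  unfold S1 S3
  rw [g1, g2]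
  have b1 : 2 * (n + i + j + 1) + 1 - (n + i + 1) - (n + 1) = i + 2 * j + 1 := by omega
  have b2 : 2 * (n + i + j + 1) + 1 - (n + i) - n = i + 2 * j + 3 := by omega
  have b3 : n + i + j + 1 - (n + i) = j + 1 := by omega
  have b4 : n + i + j + 1 - (n + i + 1) = j := by omega
  have b5 : n + i + j + 1 - n = i + j + 1 := by omega
  have b6 : n + i + 2 * (j + 1) = n + i + 2 * j + 1 + 1 := by omega
  have b7 : n + i + 1 + 2 * j = n + i + 2 * j + 1 := by omega
  have b8 : i + 2 * (j + 1) + 1 = i + 2 * j + 1 + 1 + 1 := by omega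
  have b9 : i + (j + 1) = i + j + 1 := by omega
  have b10 : i + 2 * j + 3 - 1 = i + 2 * j + 2 := by omega
  have b11 : i + 2 * j + 2 - 1 = i + 2 * j + 1 := by omega
  rw [b1, b2, b3, b4, b5, b6, b7, b8, b9, b10, b11, Nat.add_sub_cancel,
    Nat.factorial_succ n, Nat.factorial_succ (n + i + 2 * j + 1),
    Nat.factorial_succ (i + 2 * j + 1 + 1), Nat.factorial_succ (i + 2 * j + 1),
    Nat.factorial_succ j, Nat.factorial_succ (i + j)]
  have e1 : (n.factorial : ℝ) ≠ 0 := by exact_mod_cast n.factorial_ne_zero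
  have e2 : (i.factorial : ℝ) ≠ 0 := by exact_mod_cast i.factorial_ne_zero
  have e3 : (j.factorial : ℝ) ≠ 0 := by exact_mod_cast j.factorial_ne_zero
  have e4 : ((i + 2 * j + 1).factorial : ℝ) ≠ 0 := by
    exact_mod_cast (i + 2 * j + 1).factorial_ne_zero
  push_cast
  field_simp
  ring

lemma S2_shift (k : ℕ) (T w d : ℝ) (r n : ℕ) (hr : r ≤ k) (hn : n < r) :
    S2 k T w d r (n + 1) = S3 k T w d r n * ((r - n : ℕ) / (k - n : ℕ)) := by
  obtain ⟨i, rfl⟩ := Nat.exists_eq_add_of_lt hn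
  obtain ⟨j, rfl⟩ := Nat.exists_eq_add_of_le hr
  have g1 := gco_eq (n + 1) i j
  have g2 := gco_eq n (i + 1) j
  have a1 : n + 1 + i + j = n + i + 1 + j := by omega
  have a2 : n + 1 + i = n + i + 1 := by omega
  have a3 : n + (i + 1) = n + i + 1 := by omega
  rw [a1, a2] at g1
  rw [a3] at g2
  unfold S2 S3
  rw [g1, g2]
  have b1 : 2 * (n + i + 1 + j) + 1 - (n + i + 1) - (n + 1) = i + 2 * j + 1 := by omega
  have b2 : 2 * (n + i + 1 + j) + 1 - (n + i + 1) - n = i + 2 * j + 2 := by omega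
  have b3 : n + i + 1 + j - (n + i + 1) = j := by omega
  have b4 : n + i + 1 - n = i + 1 := by omega
  have b5 : n + i + 1 + j - n = i + j + 1 := by omega
  have b8 : i + 1 + 2 * j + 1 = i + 2 * j + 1 + 1 := by omega
  have b9 : i + 1 + j = i + j + 1 := by omega
  have b10 : i + 2 * j + 2 - 1 = i + 2 * j + 1 := by omega
  rw [b1, b2, b3, b4, b5, b8, b9, b10, Nat.add_sub_cancel, Nat.add_sub_cancel,
    Nat.factorial_succ n, Nat.factorial_succ (i + 2 * j + 1),
    Nat.factorial_succ i, Nat.factorial_succ (i + j)]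
  have e1 : (n.factorial : ℝ) ≠ 0 := by exact_mod_cast n.factorial_ne_zero
  have e2 : (i.factorial : ℝ) ≠ 0 := by exact_mod_cast i.factorial_ne_zero
  have e3 : (j.factorial : ℝ) ≠ 0 := by exact_mod_cast j.factorial_ne_zero
  have e4 : ((i + 2 * j + 1).factorial : ℝ) ≠ 0 := by
    exact_mod_cast (i + 2 * j + 1).factorial_ne_zero
  push_cast
  field_simp
  ring

lemma S_sum (k : ℕ) (T w d : ℝ) :
    ∑ r ∈ Finset.range (k + 1), ∑ n ∈ Finset.range (r + 1),
      (S1 k T w d r n + S2 k T w d r n - S3 k T w d r n) = 0 := by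
  have z1 : ∀ r, S1 k T w d r 0 = 0 := by intro r; simp [S1]
  have z2 : ∀ r, S2 k T w d r 0 = 0 := by intro r; simp [S2]
  have h1 : ∑ r ∈ Finset.range (k + 1), ∑ n ∈ Finset.range (r + 1), S1 k T w d r n =
      ∑ r ∈ Finset.range (k + 1), ∑ n ∈ Finset.range (r + 1),
        S3 k T w d r n * ((k - r : ℕ) / (k - n : ℕ)) := by
    rw [Finset.sum_range_succ']
    rw [Finset.sum_range_succ (fun r => ∑ n ∈ Finset.range (r + 1),
        S3 k T w d r n * (((k - r : ℕ) : ℝ) / (k - n : ℕ)))]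
    congr 1
    · refine Finset.sum_congr rfl fun r hr => ?_
      rw [Finset.sum_range_succ', z1, add_zero]
      refine Finset.sum_congr rfl fun n hn => ?_
      rw [Finset.mem_range] at hr hn
      exact S1_shift k T w d r n hr (by omega)
    · simp [z1]
  have h2 : ∑ r ∈ Finset.range (k + 1), ∑ n ∈ Finset.range (r + 1), S2 k T w d r n =
      ∑ r ∈ Finset.range (k + 1), ∑ n ∈ Finset.range (r + 1),
        S3 k T w d r n * ((r - n : ℕ) / (k - n : ℕ)) := by
    refine Finset.sum_congr rfl fun r hr => ?_
    rw [Finset.sum_range_succ', z2, Finset.sum_range_succ]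
    congr 1
    · refine Finset.sum_congr rfl fun n hn => ?_
      rw [Finset.mem_range] at hr hn
      exact S2_shift k T w d r n (by omega) hn
    · simp
  have h3 : ∑ r ∈ Finset.range (k + 1), ∑ n ∈ Finset.range (r + 1), S3 k T w d r n =
      ∑ r ∈ Finset.range (k + 1), ∑ n ∈ Finset.range (r + 1),
        (S3 k T w d r n * ((k - r : ℕ) / (k - n : ℕ)) +
        S3 k T w d r n * ((r - n : ℕ) / (k - n : ℕ))) := by
    refine Finset.sum_congr rfl fun r hr => Finset.sum_congr rfl fun n hn => ?_
    rw [Finset.mem_range] at hr hn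
    by_cases hk : n = k
    · have : r = k := by omega
      subst this; subst hk
      simp [S3_last]
    · have h0 : ((k - n : ℕ) : ℝ) ≠ 0 := by
        have : k - n ≠ 0 := by omega
        exact_mod_cast this
      rw [← mul_add, ← add_div, ← Nat.cast_add]
      have : k - r + (r - n) = k - n := by omega
      rw [this, div_self h0, mul_one]
  simp only [Finset.sum_sub_distrib, Finset.sum_add_distrib] at *
  rw [h1, h2, h3]
  ring

noncomputable def GG (k : ℕ) (T a b : ℝ) : ℝ :=
  ∑ r ∈ Finset.range (k + 1), ∑ n ∈ Finset.range (r + 1),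
    gco k r n * T ^ (k - r) * ((T * a - 1) ^ n * (b ^ n * (b - a) ^ (2 * k + 1 - r - n)))

noncomputable def DD (k : ℕ) (T a b : ℝ) : ℝ :=
  ∑ r ∈ Finset.range (k + 1), ∑ n ∈ Finset.range (r + 1),
    gco k r n * T ^ (k - r) * ((T * a - 1) ^ n * (n * b ^ (n - 1) * (b - a) ^ (2 * k + 1 - r - n)
      + b ^ n * ((2 * k + 1 - r - n : ℕ) * (b - a) ^ (2 * k + 1 - r - n - 1))))

lemma GG_deriv (k : ℕ) (T a b : ℝ) : HasDerivAt (fun b => GG k T a b) (DD k T a b) b := by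
  unfold GG DD
  refine HasDerivAt.fun_sum fun r _ => HasDerivAt.fun_sum fun n _ => ?_
  refine HasDerivAt.const_mul _ (HasDerivAt.const_mul _ ?_)
  have h1 := hasDerivAt_pow n b
  have h2 := ((hasDerivAt_id b).sub_const a).fun_pow (2 * k + 1 - r - n)
  simpa using h1.fun_mul h2

lemma DD_deriv (k : ℕ) (T a b : ℝ) : HasDerivAt (fun a => DD k T a b) 0 a := by
  rw [← S_sum k T ((T * a - 1) * b) (b - a)]
  unfold DD
  refine HasDerivAt.fun_sum fun r _ => HasDerivAt.fun_sum fun n _ => ?_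
  have h0 := ((((hasDerivAt_id a).const_mul T).sub_const 1).fun_pow n)
  have h1 := ((hasDerivAt_id a).const_sub b).fun_pow (2 * k + 1 - r - n)
  have h2 := ((hasDerivAt_id a).const_sub b).fun_pow (2 * k + 1 - r - n - 1)
  have h3 := (h0.fun_mul ((h1.const_mul (n * b ^ (n - 1))).fun_add
    ((h2.const_mul ((2 * k + 1 - r - n : ℕ) : ℝ)).const_mul (b ^ n)))).const_mul
      (gco k r n * T ^ (k - r))
  refine h3.congr_deriv ?_
  unfold S1 S2 S3
  simp only [id]
  generalize 2 * k + 1 - r - n = e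
  rw [← mul_add, ← mul_sub]
  congr 1
  simp only [mul_pow]
  rcases n with _ | n <;> rcases e with _ | e
  · simp
  · simp; ring
  · simp; ring
  · simp only [Nat.add_sub_cancel]
    push_cast
    ring

lemma GG_self (k : ℕ) (T a : ℝ) : GG k T a a = 0 := by
  unfold GG
  refine Finset.sum_eq_zero fun r hr => Finset.sum_eq_zero fun n hn => ?_
  rw [Finset.mem_range] at hr hn
  have : 2 * k + 1 - r - n ≠ 0 := by omega
  simp [this]

lemma GG_add (k : ℕ) (T a a' b : ℝ) : GG k T a b = GG k T a' b + GG k T a a' := by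
  have hD : ∀ b, DD k T a b = DD k T a' b := fun b =>
    is_const_of_deriv_eq_zero (f := fun a => DD k T a b)
      (fun x => (DD_deriv k T x b).differentiableAt) (fun x => (DD_deriv k T x b).deriv) a a'
  have hG : ∀ x, HasDerivAt (fun b => GG k T a b - GG k T a' b) 0 x := fun x => by
    have := (GG_deriv k T a x).fun_sub (GG_deriv k T a' x)
    rwa [hD, sub_self] at this
  have := is_const_of_deriv_eq_zero (fun x => (hG x).differentiableAt)
    (fun x => (hG x).deriv) b a'
  simp only [GG_self] at this
  linarith

lemma GG_cyc (k : ℕ) (T a b c : ℝ) : GG k T b c + GG k T c a + GG k T a b = 0 := by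
  have h1 := GG_add k T a b c
  have h2 := GG_add k T a c a
  rw [GG_self] at h2
  linarith

lemma GG_FF (k : ℕ) (T X Y Z : ℝ) (hY : Y ≠ 0) (hZ : Z ≠ 0) :
    ∑ r ∈ Finset.range (k + 1), ∑ n ∈ Finset.range (r + 1),
      gco k r n * T ^ (k - r) *
        (X ^ (2 * k + 1) * (T - Y) ^ n * (Y - Z) ^ (2 * k + 1 - r - n) * Y ^ r * Z ^ r) =
    (X * Y * Z) ^ (2 * k + 1) * GG k T Y⁻¹ Z⁻¹ := by
  unfold GG
  simp only [Finset.mul_sum]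
  refine Finset.sum_congr rfl fun r hr => Finset.sum_congr rfl fun n hn => ?_
  rw [Finset.mem_range] at hr hn
  have e1 : T * Y⁻¹ - 1 = (T - Y) / Y := by field_simp
  have e2 : Z⁻¹ - Y⁻¹ = (Y - Z) / (Y * Z) := by field_simp
  rw [e1, e2]
  obtain ⟨e, he⟩ : ∃ e, 2 * k + 1 = r + n + e := ⟨2 * k + 1 - r - n, by omega⟩
  have he' : 2 * k + 1 - r - n = e := by omega
  rw [he', he]
  simp only [div_pow, mul_pow, pow_add, inv_pow]
  field_simp

lemma real_id (k : ℕ) (T X Y Z : ℝ) (hX : X ≠ 0) (hY : Y ≠ 0) (hZ : Z ≠ 0) :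
    ∑ r ∈ Finset.range (k + 1), ∑ n ∈ Finset.range (r + 1),
      gco k r n * T ^ (k - r) *
        (X ^ (2 * k + 1) * (T - Y) ^ n * (Y - Z) ^ (2 * k + 1 - r - n) * Y ^ r * Z ^ r
          + Y ^ (2 * k + 1) * (T - Z) ^ n * (Z - X) ^ (2 * k + 1 - r - n) * Z ^ r * X ^ r
          + Z ^ (2 * k + 1) * (T - X) ^ n * (X - Y) ^ (2 * k + 1 - r - n) * X ^ r * Y ^ r) = 0 := by
  simp only [mul_add, Finset.sum_add_distrib]
  have h1 := GG_FF k T X Y Z hY hZ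
  have h2 := GG_FF k T Y Z X hZ hX
  have h3 := GG_FF k T Z X Y hX hY
  rw [h1, h2, h3]
  have e2 : Y * Z * X = X * Y * Z := by ring
  have e3 : Z * X * Y = X * Y * Z := by ring
  rw [e2, e3, ← mul_add, ← mul_add, GG_cyc, mul_zero]

theorem stmt_4 (k : ℕ) :
    let T : MvPolynomial (Fin 4) ℚ := X 0
    let Xv : MvPolynomial (Fin 4) ℚ := X 1
    let Y : MvPolynomial (Fin 4) ℚ := X 2
    let Z : MvPolynomial (Fin 4) ℚ := X 3
    ∑ r ∈ Finset.range (k + 1), ∑ n ∈ Finset.range (r + 1),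
        C (((k + 1 : ℕ) : ℚ) / ((2 * k + 1 - r : ℕ) : ℚ)
            * (Nat.choose (2 * k + 1 - r) n : ℚ) * (Nat.choose (k - n) (r - n) : ℚ)) *
          T ^ (k - r) *
          (Xv ^ (2 * k + 1) * (T - Y) ^ n * (Y - Z) ^ (2 * k + 1 - r - n) * Y ^ r * Z ^ r
            + Y ^ (2 * k + 1) * (T - Z) ^ n * (Z - Xv) ^ (2 * k + 1 - r - n) * Z ^ r * Xv ^ r
            + Z ^ (2 * k + 1) * (T - Xv) ^ n * (Xv - Y) ^ (2 * k + 1 - r - n) * Xv ^ r * Y ^ r)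
      = 0 := by
  intro T Xv Y Z
  have hne : Xv * Y * Z ≠ 0 :=
    mul_ne_zero (mul_ne_zero (X_ne_zero _) (X_ne_zero _)) (X_ne_zero _)
  refine (mul_eq_zero.mp ?_).resolve_left hne
  refine MvPolynomial.funext fun v => ?_
  rw [map_mul, map_zero, mul_eq_zero, or_iff_not_imp_left]
  intro hv
  simp only [map_mul, Xv, Y, Z, eval_X, mul_eq_zero, not_or] at hv
  obtain ⟨⟨h1, h2⟩, h3⟩ := hv
  have key := real_id k (v 0) (v 1) (v 2) (v 3) (by exact_mod_cast h1) (by exact_mod_cast h2)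
    (by exact_mod_cast h3)
  simp only [map_sum, map_mul, map_add, map_sub, map_pow, T, Xv, Y, Z, eval_X, eval_C]
  unfold gco at key
  apply Rat.cast_injective (α := ℝ)
  push_cast at key ⊢
  exact key
end

section
/- Let R be a polynomial ring over ℤ and F₁, F₂, F₃, G₁, G₂, G₃ ∈ R with F₁, F₂, F₃ a regular sequence and F₁G₁ + F₂G₂ + F₃G₃ = 0. Let p be a prime, q = p^e, and k = q-1. Then ((F₁G₁)^q + (F₂G₂)^q + (F₃G₃)^q)/p · (G₁G₂G₃)^k ∈ (G₁^{q+k}, G₂^{q+k}, G₃^{q+k})R. -/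
open Finset in
/-- The universal bihomogeneous sum. -/
def EE {A : Type*} [CommRing A] (k : ℕ) (X Y a b : A) : A :=
  ∑ x ∈ antidiagonal k, (k.choose x.1 : A) * ∑ y ∈ antidiagonal x.2,
    ((k + y.1).choose k : A) * ((k + y.2).choose k : A) * (a ^ y.1 * b ^ y.2) *
      (X ^ (k - y.1) * Y ^ (k - y.2))

noncomputable def IS {K : Type*} [Field K] (k : ℕ) (d : K) : PowerSeries K :=
  PowerSeries.C ((d⁻¹) ^ (k + 1)) *
    PowerSeries.rescale (-d⁻¹) (PowerSeries.mk fun n => ((k + n).choose k : K))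

theorem IS_mul {K : Type*} [Field K] (k : ℕ) (d : K) (hd : d ≠ 0) :
    IS k d * (PowerSeries.X + PowerSeries.C d) ^ (k + 1) = 1 := by
  have h1 : (PowerSeries.X + PowerSeries.C d : PowerSeries K)
      = PowerSeries.C d * PowerSeries.rescale (-d⁻¹) (1 - PowerSeries.X) := by
    rw [map_sub, map_one, PowerSeries.rescale_X, map_neg, mul_sub, neg_mul, mul_neg,
      ← mul_assoc, ← map_mul, mul_inv_cancel₀ hd]
    simp [add_comm]
  rw [h1, IS, ← PowerSeries.mk_one_pow_eq_mk_choose_add, mul_pow, map_pow, map_pow,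
    mul_mul_mul_comm, ← mul_pow, ← mul_pow, ← map_mul, ← map_mul,
    PowerSeries.mk_one_mul_one_sub_eq_one, inv_mul_cancel₀ hd]
  simp

theorem coeff_IS {K : Type*} [Field K] (k : ℕ) (d : K) (n : ℕ) :
    PowerSeries.coeff n (IS k d) = (d⁻¹) ^ (k + 1) * ((-d⁻¹) ^ n * ((k + n).choose k : K)) := by
  rw [IS, PowerSeries.coeff_C_mul, PowerSeries.coeff_rescale, PowerSeries.coeff_mk]

theorem EE_field {K : Type*} [Field K] (k : ℕ) (c d d' X Y a b : K)
    (hX : X ≠ 0) (hY : Y ≠ 0) (ha : -d⁻¹ * c = a / X) (hb : -d'⁻¹ * c = b / Y) :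
    PowerSeries.coeff k ((PowerSeries.X + PowerSeries.C c) ^ k * (IS k d * IS k d')) *
      (X ^ k * Y ^ k) =
      (d⁻¹ * d'⁻¹) ^ (k + 1) * EE k X Y a b := by
  rw [PowerSeries.coeff_mul, EE, Finset.sum_mul, Finset.mul_sum]
  refine Finset.sum_congr rfl fun x hx => ?_
  have hx' := Finset.HasAntidiagonal.mem_antidiagonal.1 hx
  have h2 : PowerSeries.coeff x.1 ((PowerSeries.X + PowerSeries.C c) ^ k) =
      c ^ x.2 * (k.choose x.1 : K) := by
    have : ((PowerSeries.X + PowerSeries.C c) ^ k : PowerSeries K) =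
      (((Polynomial.X + Polynomial.C c) ^ k : Polynomial K) : PowerSeries K) := by simp
    rw [this, Polynomial.coeff_coe, Polynomial.coeff_X_add_C_pow]
    congr 2; omega
  rw [h2, PowerSeries.coeff_mul, Finset.mul_sum, Finset.sum_mul, Finset.mul_sum, Finset.mul_sum]
  refine Finset.sum_congr rfl fun y hy => ?_
  have hy' := Finset.HasAntidiagonal.mem_antidiagonal.1 hy
  rw [coeff_IS, coeff_IS, ← hy', pow_add]
  have e1 : a ^ y.1 * X ^ (k - y.1) = (-d⁻¹ * c) ^ y.1 * X ^ k := by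
    rw [ha, div_pow, div_mul_eq_mul_div, eq_div_iff (pow_ne_zero _ hX), mul_assoc, ← pow_add]
    congr 2; omega
  have e2 : b ^ y.2 * Y ^ (k - y.2) = (-d'⁻¹ * c) ^ y.2 * Y ^ k := by
    rw [hb, div_pow, div_mul_eq_mul_div, eq_div_iff (pow_ne_zero _ hY), mul_assoc, ← pow_add]
    congr 2; omega
  calc _ = (d⁻¹ * d'⁻¹) ^ (k + 1) * ((k.choose x.1 : K) * (((k + y.1).choose k : K) * ((k + y.2).choose k : K) *
      (((-d⁻¹ * c) ^ y.1 * X ^ k) * ((-d'⁻¹ * c) ^ y.2 * Y ^ k)))) := by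
        rw [mul_pow (-d⁻¹), mul_pow (-d'⁻¹), mul_pow d⁻¹]; ring
    _ = _ := by rw [← e1, ← e2]; ring

open Polynomial in
theorem res_eq {K : Type*} [Field K] (k : ℕ) (c₁ c₂ c₃ : K) (h2 : c₁ - c₂ ≠ 0) (h3 : c₁ - c₃ ≠ 0)
    (r s : K[X]) (hr : r.degree < ((k + 1 : ℕ) : WithBot ℕ))
    (h : (X : K[X]) ^ k = r * ((X - C c₂) ^ (k + 1) * (X - C c₃) ^ (k + 1)) + (X - C c₁) ^ (k + 1) * s) :
    r.coeff k = PowerSeries.coeff k ((PowerSeries.X + PowerSeries.C c₁) ^ k *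
      (IS k (c₁ - c₂) * IS k (c₁ - c₃))) := by
  have h' := congrArg (fun f => ((taylorAlgHom c₁ f : K[X]) : PowerSeries K)) h
  have t (c : K) : taylor c₁ (X - C c) = X + C (c₁ - c) := by
    simp [taylor_X, taylor_C]; ring
  simp only [map_add, map_mul, map_pow, taylorAlgHom_apply, t] at h'
  simp only [taylor_X, sub_self, C_0, add_zero, Polynomial.coe_add, Polynomial.coe_mul, Polynomial.coe_pow,
    Polynomial.coe_X, Polynomial.coe_C] at h'
  have hc : (taylor c₁ r).coeff k = r.coeff k := by
    rcases eq_or_ne r.natDegree k with hk | hk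
    · rw [← hk, coeff_taylor_natDegree]; rfl
    · have : r.natDegree < k := by
        by_cases h0 : r = 0
        · subst h0; simp at hk ⊢; omega
        · rw [← natDegree_lt_iff_degree_lt h0] at hr; omega
      rw [coeff_eq_zero_of_natDegree_lt this,
        coeff_eq_zero_of_natDegree_lt (by rwa [natDegree_taylor])]
  rw [h', add_mul, map_add, ← hc, ← Polynomial.coeff_coe]
  have a2 := IS_mul k _ h2
  have a3 := IS_mul k _ h3
  have z : PowerSeries.coeff k (PowerSeries.X ^ (k + 1) * ((taylor c₁ s : K[X]) : PowerSeries K) *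
      (IS k (c₁ - c₂) * IS k (c₁ - c₃))) = 0 := by
    rw [mul_assoc, PowerSeries.coeff_X_pow_mul']
    simp
  rw [z, add_zero]
  congr 1
  linear_combination (-((taylor c₁ r : K[X]) : PowerSeries K)) * a2 - ((taylor c₁ r : K[X]) : PowerSeries K) *
    (IS k (c₁ - c₂) * (PowerSeries.X + PowerSeries.C (c₁ - c₂)) ^ (k + 1)) * (a3)

open Polynomial in
theorem res_sum {K : Type*} [Field K] (k : ℕ) (c : Fin 3 → K) (hc : Function.Injective c) :
    PowerSeries.coeff k ((PowerSeries.X + PowerSeries.C (c 0)) ^ k *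
      (IS k (c 0 - c 1) * IS k (c 0 - c 2))) +
    PowerSeries.coeff k ((PowerSeries.X + PowerSeries.C (c 1)) ^ k *
      (IS k (c 1 - c 2) * IS k (c 1 - c 0))) +
    PowerSeries.coeff k ((PowerSeries.X + PowerSeries.C (c 2)) ^ k *
      (IS k (c 2 - c 0) * IS k (c 2 - c 1))) = 0 := by
  have hm (i) : ((X - C (c i)) ^ (k + 1)).Monic := (monic_X_sub_C _).pow _
  obtain ⟨Q, r, hr, h⟩ := eq_quo_mul_prod_add_sum_rem_mul_prod (s := (Finset.univ : Finset (Fin 3)))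
    ((X : K[X]) ^ k) (g := fun i => (X - C (c i)) ^ (k + 1)) (fun i _ => hm i)
    (fun i _ j _ hij => (isCoprime_X_sub_C_of_isUnit_sub
      (isUnit_iff_ne_zero.2 (sub_ne_zero.2 (hc.ne hij)))).pow)
  have E0 : (Finset.univ : Finset (Fin 3)).erase 0 = {1, 2} := by decide
  have E1 : (Finset.univ : Finset (Fin 3)).erase 1 = {2, 0} := by decide
  have E2 : (Finset.univ : Finset (Fin 3)).erase 2 = {0, 1} := by decide
  rw [Fin.sum_univ_three, Fin.prod_univ_three, E0, E1, E2, Finset.prod_pair (by decide),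
    Finset.prod_pair (by decide), Finset.prod_pair (by decide)] at h
  have hd (i) : ((X - C (c i)) ^ (k + 1)).degree = ((k + 1 : ℕ) : WithBot ℕ) := by
    rw [degree_pow, degree_X_sub_C]; simp
  have hr' (i) : (r i).degree < ((k + 1 : ℕ) : WithBot ℕ) := by
    rw [← hd i]; exact hr i (Finset.mem_univ i)
  have hnd (i) : (r i).natDegree ≤ k := by
    have := natDegree_le_of_degree_le (hr' i).le
    by_cases h0 : r i = 0
    · simp [h0]
    · have := hr' i
      rw [← natDegree_lt_iff_degree_lt h0] at this; omega
  have hMnd (i) : ((X - C (c i)) ^ (k + 1)).natDegree = k + 1 := by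
    rw [natDegree_pow, natDegree_X_sub_C, mul_one]
  rw [← res_eq k (c 0) (c 1) (c 2) (sub_ne_zero.2 (hc.ne (by decide))) (sub_ne_zero.2 (hc.ne (by decide)))
      (r 0) (Q * ((X - C (c 1)) ^ (k + 1) * (X - C (c 2)) ^ (k + 1)) + r 1 * (X - C (c 2)) ^ (k + 1)
        + r 2 * (X - C (c 1)) ^ (k + 1)) (hr' 0) (by rw [h]; ring),
    ← res_eq k (c 1) (c 2) (c 0) (sub_ne_zero.2 (hc.ne (by decide))) (sub_ne_zero.2 (hc.ne (by decide)))
      (r 1) (Q * ((X - C (c 0)) ^ (k + 1) * (X - C (c 2)) ^ (k + 1)) + r 0 * (X - C (c 2)) ^ (k + 1)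
        + r 2 * (X - C (c 0)) ^ (k + 1)) (hr' 1) (by rw [h]; ring),
    ← res_eq k (c 2) (c 0) (c 1) (sub_ne_zero.2 (hc.ne (by decide))) (sub_ne_zero.2 (hc.ne (by decide)))
      (r 2) (Q * ((X - C (c 0)) ^ (k + 1) * (X - C (c 1)) ^ (k + 1)) + r 0 * (X - C (c 1)) ^ (k + 1)
        + r 1 * (X - C (c 0)) ^ (k + 1)) (hr' 2) (by rw [h]; ring)]
  have hP (i j) : ((X - C (c i)) ^ (k + 1) * (X - C (c j)) ^ (k + 1)).natDegree = 2 * k + 2 := by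
    rw [(hm i).natDegree_mul (hm j), hMnd, hMnd]; ring
  have hP1 (i j) : ((X - C (c i)) ^ (k + 1) * (X - C (c j)) ^ (k + 1)).coeff (2 * k + 2) = 1 := by
    rw [← hP i j]; exact (hm i).mul (hm j)
  have key (i j l) : (r i * ((X - C (c j)) ^ (k + 1) * (X - C (c l)) ^ (k + 1))).coeff
      (k + (2 * k + 2)) = (r i).coeff k := by
    rw [coeff_mul_add_eq_of_natDegree_le (hnd i) (hP j l).le, hP1, mul_one]
  have hM2 (i j) := (hm i).mul (hm j)
  have hm0 := hm 2
  have hb (i j l) : (r i * ((X - C (c j)) ^ (k + 1) * (X - C (c l)) ^ (k + 1))).natDegree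
      ≤ 3 * k + 2 := by
    refine natDegree_mul_le.trans ?_
    rw [hP]; have := hnd i; omega
  have hQ : Q = 0 := by
    by_contra hQ
    have hM3 : ((X - C (c 0)) ^ (k + 1) * (X - C (c 1)) ^ (k + 1) *
        (X - C (c 2)) ^ (k + 1)).natDegree = 3 * k + 3 := by
      rw [(hM2 0 1).natDegree_mul (hm 2), hP, hMnd]; ring
    have hM3' := ((hM2 0 1).mul (hm 2)).ne_zero
    have b0 := hb 0 1 2
    have b1 := hb 1 2 0
    have b2 := hb 2 0 1
    have bX : ((X : K[X]) ^ k).natDegree ≤ 3 * k + 2 := by rw [natDegree_X_pow]; omega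
    clear hP1 hP key hM2 hm0 hb
    generalize (X - C (c 0)) ^ (k + 1) * (X - C (c 1)) ^ (k + 1) * (X - C (c 2)) ^ (k + 1) = M at *
    generalize r 0 * _ = t0 at *
    generalize r 1 * _ = t1 at *
    generalize r 2 * _ = t2 at *
    have h3 : Q * M = X ^ k - (t0 + t1 + t2) := by rw [h]; ring
    have h4 : (X ^ k - (t0 + t1 + t2)).natDegree ≤ 3 * k + 2 :=
      (natDegree_sub_le_of_le bX
        (natDegree_add_le_of_degree_le (natDegree_add_le_of_degree_le b0 b1) b2)).trans (max_self _).le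
    rw [← h3, natDegree_mul hQ hM3', hM3] at h4
    omega
  have h5 := congrArg (fun f => coeff f (k + (2 * k + 2))) h
  simp only [hQ, zero_mul, zero_add, coeff_add, key, coeff_X_pow] at h5
  rw [← h5, if_neg (by omega)]

theorem pow_aux {K : Type*} [Field K] (n : ℕ) (a b c d e : K) (h : a * b = c * d) :
    a ^ n * e * b ^ n = c ^ n * e * d ^ n := by
  rw [mul_right_comm, ← mul_pow, h, mul_pow, mul_right_comm]

theorem ident_field {K : Type*} [Field K] (k : ℕ) (x y z u v w : K) (hx : x ≠ 0) (hy : y ≠ 0)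
    (hz : z ≠ 0) (h1 : v * z - w * y ≠ 0) (h2 : w * x - u * z ≠ 0) (h3 : u * y - v * x ≠ 0) :
    x ^ (k + 1) * (v * z - w * y) ^ (2 * k + 1) *
        EE k (u * y - v * x) (w * x - u * z) (-(y * u)) (z * u) +
      y ^ (k + 1) * (w * x - u * z) ^ (2 * k + 1) *
        EE k (v * z - w * y) (u * y - v * x) (-(z * v)) (x * v) +
      z ^ (k + 1) * (u * y - v * x) ^ (2 * k + 1) *
        EE k (w * x - u * z) (v * z - w * y) (-(x * w)) (y * w) = 0 := by
  have d01 : u / x - v / y = (u * y - v * x) / (x * y) := by field_simp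
  have d12 : v / y - w / z = (v * z - w * y) / (y * z) := by field_simp
  have d20 : w / z - u / x = (w * x - u * z) / (z * x) := by field_simp
  have d10 : v / y - u / x = -((u * y - v * x) / (x * y)) := by rw [← d01]; ring
  have d21 : w / z - v / y = -((v * z - w * y) / (y * z)) := by rw [← d12]; ring
  have d02 : u / x - w / z = -((w * x - u * z) / (z * x)) := by rw [← d20]; ring
  have hinj : Function.Injective ![u / x, v / y, w / z] := by
    have n01 : u / x ≠ v / y := sub_ne_zero.1 (by rw [d01]; positivity)
    have n12 : v / y ≠ w / z := sub_ne_zero.1 (by rw [d12]; positivity)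
    have n20 : w / z ≠ u / x := sub_ne_zero.1 (by rw [d20]; positivity)
    intro i j
    fin_cases i <;> fin_cases j <;> simp [n01, n12, n20, n01.symm, n12.symm, n20.symm]
  have hs := res_sum k _ hinj
  simp only [Matrix.cons_val_zero, Matrix.cons_val_one, Matrix.cons_val] at hs
  rw [d01, d12, d20, d10, d21, d02] at hs
  generalize hA : v * z - w * y = A at *
  generalize hB : w * x - u * z = B at *
  generalize hC : u * y - v * x = C at *
  have r0 := EE_field k (u / x) (C / (x * y)) (-(B / (z * x))) C B (-(y * u)) (z * u) h3 h2
    (by field_simp) (by field_simp)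
  have r1 := EE_field k (v / y) (A / (y * z)) (-(C / (x * y))) A C (-(z * v)) (x * v) h1 h3
    (by field_simp) (by field_simp)
  have r2 := EE_field k (w / z) (B / (z * x)) (-(A / (y * z))) B A (-(x * w)) (y * w) h2 h1
    (by field_simp) (by field_simp)
  generalize PowerSeries.coeff k ((PowerSeries.X + PowerSeries.C (u / x)) ^ k *
    (IS k (C / (x * y)) * IS k (-(B / (z * x))))) = s0 at r0 hs
  generalize PowerSeries.coeff k ((PowerSeries.X + PowerSeries.C (v / y)) ^ k *
    (IS k (A / (y * z)) * IS k (-(C / (x * y))))) = s1 at r1 hs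
  generalize PowerSeries.coeff k ((PowerSeries.X + PowerSeries.C (w / z)) ^ k *
    (IS k (B / (z * x)) * IS k (-(A / (y * z))))) = s2 at r2 hs
  generalize EE k C B (-(y * u)) (z * u) = e0 at r0 ⊢
  generalize EE k A C (-(z * v)) (x * v) = e1 at r1 ⊢
  generalize EE k B A (-(x * w)) (y * w) = e2 at r2 ⊢
  have q0 : x ^ (k + 1) * e0 * (-(x * y * z)) ^ (k + 1) = s0 * (C ^ (2 * k + 1) * B ^ (2 * k + 1)) := by
    have : (C ^ (2 * k + 1) * B ^ (2 * k + 1)) = (C ^ k * B ^ k) * (C * B) ^ (k + 1) := by ring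
    rw [this, ← mul_assoc, r0]
    exact pow_aux _ _ _ _ _ _ (by field_simp)
  have q1 : y ^ (k + 1) * e1 * (-(x * y * z)) ^ (k + 1) = s1 * (A ^ (2 * k + 1) * C ^ (2 * k + 1)) := by
    have : (A ^ (2 * k + 1) * C ^ (2 * k + 1)) = (A ^ k * C ^ k) * (A * C) ^ (k + 1) := by ring
    rw [this, ← mul_assoc, r1]
    exact pow_aux _ _ _ _ _ _ (by field_simp)
  have q2 : z ^ (k + 1) * e2 * (-(x * y * z)) ^ (k + 1) = s2 * (B ^ (2 * k + 1) * A ^ (2 * k + 1)) := by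
    have : (B ^ (2 * k + 1) * A ^ (2 * k + 1)) = (B ^ k * A ^ k) * (B * A) ^ (k + 1) := by ring
    rw [this, ← mul_assoc, r2]
    exact pow_aux _ _ _ _ _ _ (by field_simp)
  have hne : (-(x * y * z)) ^ (k + 1) ≠ 0 := pow_ne_zero _ (neg_ne_zero.2 (mul_ne_zero (mul_ne_zero hx hy) hz))
  refine (mul_eq_zero.1 ?_).resolve_right hne
  linear_combination A ^ (2 * k + 1) * q0 + B ^ (2 * k + 1) * q1 + C ^ (2 * k + 1) * q2
    + A ^ (2 * k + 1) * B ^ (2 * k + 1) * C ^ (2 * k + 1) * hs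

theorem EE_map {A B : Type*} [CommRing A] [CommRing B] (f : A →+* B) (k : ℕ) (X Y a b : A) :
    f (EE k X Y a b) = EE k (f X) (f Y) (f a) (f b) := by
  simp [EE, map_sum]

theorem ident_ring {A : Type*} [CommRing A] (k : ℕ) (x y z u v w : A) :
    x ^ (k + 1) * (v * z - w * y) ^ (2 * k + 1) *
        EE k (u * y - v * x) (w * x - u * z) (-(y * u)) (z * u) +
      y ^ (k + 1) * (w * x - u * z) ^ (2 * k + 1) *
        EE k (v * z - w * y) (u * y - v * x) (-(z * v)) (x * v) +
      z ^ (k + 1) * (u * y - v * x) ^ (2 * k + 1) *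
        EE k (w * x - u * z) (v * z - w * y) (-(x * w)) (y * w) = 0 := by
  let S := MvPolynomial (Fin 6) ℤ
  let ι : S →+* FractionRing S := algebraMap S (FractionRing S)
  have hι : Function.Injective ι := IsFractionRing.injective S (FractionRing S)
  let T (i : Fin 6) : S := MvPolynomial.X i
  have gen : (T 0) ^ (k + 1) * (T 4 * T 2 - T 5 * T 1) ^ (2 * k + 1) *
        EE k (T 3 * T 1 - T 4 * T 0) (T 5 * T 0 - T 3 * T 2) (-(T 1 * T 3)) (T 2 * T 3) +
      (T 1) ^ (k + 1) * (T 5 * T 0 - T 3 * T 2) ^ (2 * k + 1) *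
        EE k (T 4 * T 2 - T 5 * T 1) (T 3 * T 1 - T 4 * T 0) (-(T 2 * T 4)) (T 0 * T 4) +
      (T 2) ^ (k + 1) * (T 3 * T 1 - T 4 * T 0) ^ (2 * k + 1) *
        EE k (T 5 * T 0 - T 3 * T 2) (T 4 * T 2 - T 5 * T 1) (-(T 0 * T 5)) (T 1 * T 5) = 0 := by
    apply hι
    have nz (f : S) (a : Fin 6 → ℤ) (hf : MvPolynomial.eval a f ≠ 0) : ι f ≠ 0 := by
      rw [map_ne_zero_iff ι hι]
      rintro rfl
      simp at hf
    have := ident_field k (ι (T 0)) (ι (T 1)) (ι (T 2)) (ι (T 3)) (ι (T 4)) (ι (T 5))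
      (nz _ 1 (by simp [T])) (nz _ 1 (by simp [T])) (nz _ 1 (by simp [T]))
      (by simpa only [map_sub, map_mul] using nz (T 4 * T 2 - T 5 * T 1) ![1,2,3,1,1,1] (by simp [T]))
      (by simpa only [map_sub, map_mul] using nz (T 5 * T 0 - T 3 * T 2) ![1,2,3,1,1,1] (by simp [T]))
      (by simpa only [map_sub, map_mul] using nz (T 3 * T 1 - T 4 * T 0) ![1,2,3,1,1,1] (by simp [T]))
    simpa only [map_zero, map_add, map_mul, map_pow, EE_map, map_sub, map_neg] using this
  have := congrArg (MvPolynomial.aeval (R := ℤ) ![x, y, z, u, v, w]).toRingHom gen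
  simp only [map_zero, map_add, map_mul, map_pow, EE_map, map_sub, map_neg] at this
  simpa [T] using this

theorem choose_dvd (p e i : ℕ) (hp : p.Prime) (h0 : i ≠ 0) (hi : i < p ^ e) :
    p ∣ (p ^ e - 1 + i).choose (p ^ e - 1) := by
  have hq : 0 < p ^ e := pow_pos hp.pos e
  have h3 := Nat.choose_succ_right_eq (p ^ e - 1 + i) (p ^ e - 1)
  -- C(n,q) * q = C(n,q-1) * i
  have e1 : p ^ e - 1 + 1 = p ^ e := by omega
  have e2 : p ^ e - 1 + i - (p ^ e - 1) = i := by omega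
  rw [e1, e2] at h3
  by_contra hc
  have hcop : Nat.Coprime (p ^ e) ((p ^ e - 1 + i).choose (p ^ e - 1)) :=
    Nat.Coprime.pow_left _ ((Nat.Prime.coprime_iff_not_dvd hp).2 hc)
  have : p ^ e ∣ i := hcop.dvd_of_dvd_mul_left ⟨_, by rw [← h3, mul_comm]⟩
  exact absurd (Nat.le_of_dvd (Nat.pos_of_ne_zero h0) this) (by omega)

theorem EE_mod {A : Type*} [CommRing A] (p e : ℕ) (hp : p.Prime) (X Y a b : A) :
    ∃ S, EE (p ^ e - 1) X Y a b = X ^ (p ^ e - 1) * Y ^ (p ^ e - 1) + p * S := by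
  have hq : 0 < p ^ e := pow_pos hp.pos e
  have : (p : A) ∣ EE (p ^ e - 1) X Y a b - X ^ (p ^ e - 1) * Y ^ (p ^ e - 1) := by
    unfold EE
    rw [← Finset.add_sum_erase _ _ (show (p ^ e - 1, 0) ∈ Finset.HasAntidiagonal.antidiagonal (p ^ e - 1) by simp)]
    simp only [Finset.HasAntidiagonal.antidiagonal_zero, Finset.sum_singleton, Nat.choose_self, add_zero,
      Nat.cast_one, one_mul, pow_zero, Nat.sub_zero, add_sub_cancel_left]
    refine Finset.dvd_sum fun x hx => Dvd.dvd.mul_left (Finset.dvd_sum fun y hy => ?_) _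
    rw [Finset.mem_erase, Finset.HasAntidiagonal.mem_antidiagonal] at hx
    rw [Finset.HasAntidiagonal.mem_antidiagonal] at hy
    obtain ⟨x1, x2⟩ := x
    obtain ⟨y1, y2⟩ := y
    simp only [ne_eq, Prod.mk.injEq, not_and] at hx hy ⊢
    have : y1 ≠ 0 ∨ y2 ≠ 0 := by
      by_contra hcon
      push Not at hcon
      exact hx.1 (by omega) (by omega)
    refine Dvd.dvd.mul_right (Dvd.dvd.mul_right ?_ _) _
    rcases this with h | h
    · exact Dvd.dvd.mul_right (Nat.cast_dvd_cast (choose_dvd p e y1 hp h (by omega))) _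
    · exact Dvd.dvd.mul_left (Nat.cast_dvd_cast (choose_dvd p e y2 hp h (by omega))) _
  obtain ⟨S, hS⟩ := this
  exact ⟨S, by rw [← hS]; ring⟩

theorem koszul {R : Type*} [CommRing R] (F₁ F₂ F₃ G₁ G₂ G₃ : R)
    (hreg : RingTheory.Sequence.IsRegular R [F₁, F₂, F₃])
    (hrel : F₁ * G₁ + F₂ * G₂ + F₃ * G₃ = 0) :
    ∃ u v w, G₁ = v * F₃ - w * F₂ ∧ G₂ = w * F₁ - u * F₃ ∧ G₃ = u * F₂ - v * F₁ := by
  have h := hreg.toIsWeaklyRegular.regular_mod_prev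
  have h0 := h 0 (by simp)
  have h1 := h 1 (by simp)
  have h2 := h 2 (by simp)
  rw [isSMulRegular_quotient_iff_mem_of_smul_mem] at h0 h1 h2
  simp [Ideal.ofList_cons, Ideal.mem_span_singleton'] at h0 h1 h2
  simp only [← Ideal.span_union, Set.singleton_union, Ideal.mem_span_pair] at h2
  obtain ⟨a, b, hab⟩ := h2 G₃ ⟨-G₁, -G₂, by linear_combination (-1 : R) * hrel⟩
  obtain ⟨w, hw⟩ := h1 (G₂ + b * F₃) (-(G₁ + a * F₃)) (by
    rw [← hab] at hrel
    linear_combination (-1 : R) * hrel)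
  have h3 := h0 (G₁ + a * F₃ + w * F₂) (by
    rw [← hab] at hrel
    linear_combination hrel + F₂ * hw)
  exact ⟨b, -a, w, by linear_combination h3, by linear_combination (-1 : R) * hw,
    by linear_combination (-1 : R) * hab⟩

theorem stmt_11 {σ : Type*} (p : ℕ) (hp : p.Prime) (e : ℕ) (he : 1 ≤ e) (q : ℕ)
    (hq : q = p ^ e) (k : ℕ) (hk : k = q - 1)
    (F₁ F₂ F₃ G₁ G₂ G₃ : MvPolynomial σ ℤ)
    (hreg : RingTheory.Sequence.IsRegular (MvPolynomial σ ℤ) [F₁, F₂, F₃])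
    (hrel : F₁ * G₁ + F₂ * G₂ + F₃ * G₃ = 0) :
    ∃ H : MvPolynomial σ ℤ,
      (p : MvPolynomial σ ℤ) * H = (F₁ * G₁) ^ q + (F₂ * G₂) ^ q + (F₃ * G₃) ^ q ∧
      H * (G₁ * G₂ * G₃) ^ k ∈
        Ideal.span {G₁ ^ (q + k), G₂ ^ (q + k), G₃ ^ (q + k)} := by
  have hq0 : 0 < q := hq ▸ pow_pos hp.pos e
  have hqk : q = k + 1 := by omega
  have hdvd : (p : MvPolynomial σ ℤ) ∣ (F₁ * G₁) ^ q + (F₂ * G₂) ^ q + (F₃ * G₃) ^ q := by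
    have : Fact p.Prime := ⟨hp⟩
    have hC : (p : MvPolynomial σ ℤ) = MvPolynomial.C ((p : ℕ) : ℤ) := by simp
    rw [hC, MvPolynomial.C_dvd_iff_zmod]
    rw [map_add, map_add, map_pow, map_pow, map_pow, hq, ← add_pow_char_pow, ← add_pow_char_pow,
      ← map_add, ← map_add, hrel, map_zero, zero_pow (hq ▸ hq0.ne')]
  obtain ⟨H, hH⟩ := hdvd
  refine ⟨H, hH.symm, ?_⟩
  obtain ⟨u, v, w, h1, h2, h3⟩ := koszul _ _ _ _ _ _ hreg hrel
  have id := ident_ring k F₁ F₂ F₃ u v w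
  rw [← h1, ← h2, ← h3] at id
  have hk' : k = p ^ e - 1 := by omega
  obtain ⟨S1, hS1⟩ := EE_mod p e hp G₃ G₂ (-(F₂ * u)) (F₃ * u)
  obtain ⟨S2, hS2⟩ := EE_mod p e hp G₁ G₃ (-(F₃ * v)) (F₁ * v)
  obtain ⟨S3, hS3⟩ := EE_mod p e hp G₂ G₁ (-(F₁ * w)) (F₂ * w)
  rw [← hk'] at hS1 hS2 hS3
  rw [hS1, hS2, hS3] at id
  have hp0 : (p : MvPolynomial σ ℤ) ≠ 0 := by exact_mod_cast hp.ne_zero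
  have hqk2 : q + k = 2 * k + 1 := by omega
  rw [hqk] at hH
  have fin : H * (G₁ * G₂ * G₃) ^ k = (-(F₁ ^ (k + 1) * S1)) * G₁ ^ (q + k) +
      (-(F₂ ^ (k + 1) * S2)) * G₂ ^ (q + k) + (-(F₃ ^ (k + 1) * S3)) * G₃ ^ (q + k) := by
    apply mul_left_cancel₀ hp0
    rw [hqk2]
    linear_combination id - (G₁ * G₂ * G₃) ^ k * hH
  rw [fin]
  refine add_mem (add_mem ?_ ?_) ?_ <;>
    exact Ideal.mul_mem_left _ _ (Ideal.subset_span (by simp))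
end

section
/- Let p be a prime, q = p^e, k = q-1. In the polynomial ring ℤ[A, B, T], the element ((A+B)^q + (−A)^q + (−B)^q)/p · ((A+B)·A·B)^k belongs to the ideal (A+B)^{q+k}·(T,A)^k·(T,B)^k + A^{q+k}·(T,B)^k·(T+B, A+B)^k + B^{q+k}·(T,A)^k·(T−A, A+B)^k. -/
def ffq {R : Type*} [CommRing R] (k i : ℕ) (a : R) : R := (-1) ^ i * ((k + i).choose i : R) * a ^ (k - i)

def fff {R : Type*} [CommRing R] (k : ℕ) (u a b : R) : R :=
  ∑ x ∈ Finset.HasAntidiagonal.antidiagonal k, ffq k x.1 a *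
    ∑ y ∈ Finset.HasAntidiagonal.antidiagonal x.2, ffq k y.1 b * (u ^ (k - y.2) * (k.choose y.2 : R))

lemma fff_map {R S : Type*} [CommRing R] [CommRing S] (φ : R →+* S) (k : ℕ) (u a b : R) :
    φ (fff k u a b) = fff k (φ u) (φ a) (φ b) := by
  simp [fff, ffq, map_sum]

lemma choose_dvd_aux (p : ℕ) (hp : p.Prime) (e k i : ℕ) (hk : k + 1 = p ^ e) (hi : 0 < i)
    (hik : i ≤ k) : p ∣ (k + i).choose i := by
  obtain ⟨j, rfl⟩ : ∃ j, i = j + 1 := ⟨i - 1, by omega⟩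
  have h := Nat.choose_succ_right_eq (k + (j + 1)) j
  have h2 : k + (j + 1) - j = p ^ e := by omega
  rw [h2] at h
  by_contra hc
  have hcop : Nat.Coprime (p ^ e) ((k + (j + 1)).choose (j + 1)) :=
    Nat.Coprime.pow_left _ ((Nat.Prime.coprime_iff_not_dvd hp).2 hc)
  have hd : p ^ e ∣ (k + (j + 1)).choose (j + 1) * (j + 1) := by rw [h]; exact dvd_mul_left _ _
  have := Nat.le_of_dvd (by omega) (hcop.dvd_of_dvd_mul_left hd)
  omega

lemma fff_mod {R : Type*} [CommRing R] (p : ℕ) (hp : p.Prime) (e k : ℕ) (hk : k + 1 = p ^ e)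
    (u a b : R) (I J : Ideal R) (huI : u ∈ I) (haI : a ∈ I) (huJ : u ∈ J) (hbJ : b ∈ J) :
    ∃ r ∈ I ^ k * J ^ k, fff k u a b = (a * b) ^ k + p * r := by
  have hmem : ∀ i j l, i + j + l = k →
      a ^ (k - i) * (b ^ (k - j) * u ^ (k - l)) ∈ I ^ k * J ^ k := by
    intro i j l h
    have e1 : a ^ (k - i) * (b ^ (k - j) * u ^ (k - l))
        = (a ^ (k - i) * u ^ i) * (b ^ (k - j) * u ^ j) := by
      rw [show k - l = i + j by omega, pow_add]; ring
    rw [e1]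
    refine Ideal.mul_mem_mul ?_ ?_
    · have := Ideal.mul_mem_mul (Ideal.pow_mem_pow haI (k - i)) (Ideal.pow_mem_pow huI i)
      rwa [← pow_add, show k - i + i = k by omega] at this
    · have := Ideal.mul_mem_mul (Ideal.pow_mem_pow hbJ (k - j)) (Ideal.pow_mem_pow huJ j)
      rwa [← pow_add, show k - j + j = k by omega] at this
  have hterm : ∀ i j l, i + j + l = k → 0 < i + j →
      ffq k i a * (ffq k j b * (u ^ (k - l) * (k.choose l : R))) ∈
        Ideal.span {(p : R)} * (I ^ k * J ^ k) := by
    intro i j l h hpos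
    have hd : (p : R) ∣ ((k + i).choose i : R) * ((k + j).choose j : R) := by
      rw [← Nat.cast_mul]
      apply Nat.cast_dvd_cast
      rcases Nat.eq_zero_or_pos i with h0 | h0
      · exact dvd_mul_of_dvd_right (choose_dvd_aux p hp e k j hk (by omega) (by omega)) _
      · exact dvd_mul_of_dvd_left (choose_dvd_aux p hp e k i hk (by omega) (by omega)) _
    obtain ⟨c, hc⟩ := hd
    have : ffq k i a * (ffq k j b * (u ^ (k - l) * (k.choose l : R))) =
        p * (((-1) ^ i * (-1) ^ j * (k.choose l : R) * c) *
          (a ^ (k - i) * (b ^ (k - j) * u ^ (k - l)))) := by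
      unfold ffq
      linear_combination ((-1) ^ i * (-1) ^ j * (k.choose l : R)) *
          (a ^ (k - i) * (b ^ (k - j) * u ^ (k - l))) * hc
    rw [this]
    exact Ideal.mul_mem_mul (Ideal.mem_span_singleton_self _)
      (Ideal.mul_mem_left _ _ (hmem i j l h))
  have key : fff k u a b - (a * b) ^ k ∈ Ideal.span {(p : R)} * (I ^ k * J ^ k) := by
    unfold fff
    rw [← Finset.add_sum_erase _ _ (show ((0, k) : ℕ × ℕ) ∈ Finset.HasAntidiagonal.antidiagonal k by simp)]
    dsimp only
    rw [← Finset.add_sum_erase (Finset.HasAntidiagonal.antidiagonal k) (fun y => ffq k y.1 b * (u ^ (k - y.2) * (k.choose y.2 : R))) (show ((0, k) : ℕ × ℕ) ∈ Finset.HasAntidiagonal.antidiagonal k by simp)]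
    have e0 : ∀ c : R, ffq k 0 c = c ^ k := by intro c; simp [ffq]
    rw [mul_add, add_assoc]
    have e1 : ffq k 0 a * (ffq k 0 b * (u ^ (k - k) * (k.choose k : R))) = (a * b) ^ k := by
      simp [e0, mul_pow]
    dsimp only
    rw [e1, add_sub_cancel_left]
    refine Ideal.add_mem _ ?_ ?_
    · rw [Finset.mul_sum]
      refine Ideal.sum_mem _ fun y hy => ?_
      rw [Finset.mem_erase, Finset.HasAntidiagonal.mem_antidiagonal] at hy
      refine hterm 0 y.1 y.2 (by omega) ?_
      rcases Nat.eq_zero_or_pos y.1 with h | h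
      · exact absurd (Prod.ext h (by simp; omega)) hy.1
      · omega
    · refine Ideal.sum_mem _ fun x hx => ?_
      rw [Finset.mem_erase, Finset.HasAntidiagonal.mem_antidiagonal] at hx
      rw [Finset.mul_sum]
      refine Ideal.sum_mem _ fun y hy => ?_
      rw [Finset.HasAntidiagonal.mem_antidiagonal] at hy
      refine hterm x.1 y.1 y.2 (by omega) ?_
      rcases Nat.eq_zero_or_pos x.1 with h | h
      · exact absurd (Prod.ext h (by simp; omega)) hx.1
      · omega
  rw [Ideal.mem_span_singleton_mul] at key
  obtain ⟨r, hr, h⟩ := key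
  exact ⟨r, hr, by rw [h]; ring⟩

section
open Polynomial

lemma S_dvd (K : Type*) [Field K] (k : ℕ) :
    (X : K[X]) ^ (k + 1) ∣
      (1 - X) ^ (k + 1) * (∑ i ∈ Finset.range (k + 1), C ((k + i).choose i : K) * X ^ i) - 1 := by
  set S : K[X] := ∑ i ∈ Finset.range (k + 1), C ((k + i).choose i : K) * X ^ i with hS
  have h1 : (PowerSeries.X : PowerSeries K) ^ (k + 1) ∣
      ((S : PowerSeries K) - PowerSeries.mk fun n => ((k + n).choose k : K)) := by
    rw [PowerSeries.X_pow_dvd_iff]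
    intro m hm
    rw [map_sub, Polynomial.coeff_coe, PowerSeries.coeff_mk, hS, Polynomial.finsetSum_coeff]
    simp only [Polynomial.coeff_C_mul_X_pow]
    rw [Finset.sum_ite_eq]
    simp only [Finset.mem_range, hm, if_true]
    rw [Nat.choose_symm_add, sub_self]
  have h2 : (PowerSeries.mk fun n => ((k + n).choose k : K)) * (1 - PowerSeries.X) ^ (k + 1) = 1 := by
    exact PowerSeries.mk_add_choose_mul_one_sub_pow_eq_one K k
  have h3 : (PowerSeries.X : PowerSeries K) ^ (k + 1) ∣
      (((1 - X) ^ (k + 1) * S - 1 : K[X]) : PowerSeries K) := by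
    have : (((1 - X) ^ (k + 1) * S - 1 : K[X]) : PowerSeries K) =
        (1 - PowerSeries.X) ^ (k + 1) *
        ((S : PowerSeries K) - PowerSeries.mk fun n => ((k + n).choose k : K)) := by
      push_cast
      linear_combination h2
    rw [this]
    exact dvd_mul_of_dvd_right h1 _
  rw [PowerSeries.X_pow_dvd_iff] at h3
  rw [Polynomial.X_pow_dvd_iff]
  intro d hd
  have := h3 d hd
  rwa [Polynomial.coeff_coe] at this

lemma Q_dvd {K : Type*} [Field K] (k : ℕ) (a : K) (ha : a ≠ 0) :
    (X : K[X]) ^ (k + 1) ∣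
      (X + C a) ^ (k + 1) * (∑ i ∈ Finset.range (k + 1), C (ffq k i a) * X ^ i)
        - C (a ^ (2 * k + 1)) := by
  obtain ⟨g, hg⟩ := S_dvd K k
  have h := congrArg (fun P : K[X] => P.comp (C (-a⁻¹) * X)) hg
  simp only [mul_comp, sub_comp, pow_comp, one_comp, X_comp, Polynomial.sum_comp, C_comp] at h
  have e1 : (X + C a : K[X]) = C a * (1 - C (-a⁻¹) * X) := by
    have : (C a * C a⁻¹ : K[X]) = 1 := by rw [← C_mul, mul_inv_cancel₀ ha, C_1]
    rw [C_neg]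
    linear_combination (-X) * this
  have e2 : (∑ i ∈ Finset.range (k + 1), C (ffq k i a) * X ^ i : K[X]) =
      C (a ^ k) * ∑ i ∈ Finset.range (k + 1), C ((k + i).choose i : K) * (C (-a⁻¹) * X) ^ i := by
    rw [Finset.mul_sum]
    refine Finset.sum_congr rfl fun i hi => ?_
    have hi' : i ≤ k := by simpa [Nat.lt_succ_iff] using hi
    rw [mul_pow, ← C_pow, ← mul_assoc, ← mul_assoc, ← C_mul, ← C_mul]
    congr 2
    unfold ffq
    rw [pow_sub₀ _ ha hi', neg_pow a⁻¹ i, inv_pow]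
    ring
  refine ⟨C (a ^ (2 * k + 1)) * C ((-a⁻¹) ^ (k + 1)) * g.comp (C (-a⁻¹) * X), ?_⟩
  rw [e1, e2, mul_pow (C a)]
  rw [mul_pow (C (-a⁻¹)) X (k+1)] at h
  simp only [C_pow] at h ⊢
  linear_combination (C a ^ (2 * k + 1)) * h

lemma exists_G {K : Type*} [Field K] (k : ℕ) (u v w : K) (hv : u - v ≠ 0) (hw : u - w ≠ 0) :
    ∃ G : K[X], G.natDegree ≤ k ∧ G.coeff k = fff k u (u - v) (u - w) ∧
      (X - C u) ^ (k + 1) ∣ G * (X - C v) ^ (k + 1) * (X - C w) ^ (k + 1)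
        - C (((u - v) * (u - w)) ^ (2 * k + 1)) * X ^ k := by
  set Qa : K[X] := ∑ i ∈ Finset.range (k + 1), C (ffq k i (u - v)) * X ^ i with hQa
  set Qb : K[X] := ∑ i ∈ Finset.range (k + 1), C (ffq k i (u - w)) * X ^ i with hQb
  obtain ⟨ga, hga⟩ := Q_dvd k (u - v) hv
  obtain ⟨gb, hgb⟩ := Q_dvd k (u - w) hw
  rw [← hQa] at hga
  rw [← hQb] at hgb
  set F : K[X] := Qa * (Qb * (X + C u) ^ k) with hF
  set G0 : K[X] := F %ₘ (X ^ (k + 1)) with hG0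
  have hmon : (X ^ (k + 1) : K[X]).Monic := monic_X_pow _
  have hdeg : G0.natDegree < k + 1 := by
    have := natDegree_modByMonic_lt F hmon (by
      intro h; have := congrArg natDegree h; simp at this)
    simpa using this
  have hdiv : G0 + X ^ (k + 1) * (F /ₘ X ^ (k + 1)) = F := modByMonic_add_div F _
  have hcoef : ∀ (a : K) (i : ℕ), i ≤ k →
      (∑ j ∈ Finset.range (k + 1), C (ffq k j a) * X ^ j : K[X]).coeff i = ffq k i a := by
    intro a i hi
    rw [finsetSum_coeff]
    simp only [coeff_C_mul_X_pow]
    rw [Finset.sum_ite_eq]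
    simp [Nat.lt_succ_iff, hi]
  have hcF : F.coeff k = fff k u (u - v) (u - w) := by
    rw [hF, coeff_mul]
    unfold fff
    refine Finset.sum_congr rfl fun x hx => ?_
    rw [Finset.HasAntidiagonal.mem_antidiagonal] at hx
    rw [hQa, hcoef _ _ (by omega), coeff_mul]
    congr 1
    refine Finset.sum_congr rfl fun y hy => ?_
    rw [Finset.HasAntidiagonal.mem_antidiagonal] at hy
    rw [hQb, hcoef _ _ (by omega), coeff_X_add_C_pow]
  have hcG : G0.coeff k = F.coeff k := by
    rw [← hdiv, coeff_add, coeff_X_pow_mul']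
    simp
  have hcomp : ((X - C u : K[X])).natDegree = 1 := natDegree_X_sub_C u
  refine ⟨G0.comp (X - C u), ?_, ?_, ?_⟩
  · rw [natDegree_comp, hcomp]; omega
  · rw [← hcF, ← hcG]
    rcases Nat.lt_or_ge G0.natDegree k with h | h
    · rw [coeff_eq_zero_of_natDegree_lt h, coeff_eq_zero_of_natDegree_lt]
      rw [natDegree_comp, hcomp]; omega
    · have hk : k = G0.natDegree := by omega
      have := coeff_comp_degree_mul_degree (p := G0) (q := X - C u) (by rw [hcomp]; simp)
      rw [hcomp, mul_one, ← hk, leadingCoeff_X_sub_C, one_pow, mul_one, leadingCoeff, ← hk] at this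
      exact this
  · have key : (X : K[X]) ^ (k + 1) ∣ G0 * (X + C (u - v)) ^ (k + 1) * (X + C (u - w)) ^ (k + 1)
        - C (((u - v) * (u - w)) ^ (2 * k + 1)) * (X + C u) ^ k := by
      refine ⟨- (F /ₘ X ^ (k + 1)) * (X + C (u - v)) ^ (k + 1) * (X + C (u - w)) ^ (k + 1)
        + ga * (Qb * (X + C (u - w)) ^ (k + 1)) * (X + C u) ^ k
        + C ((u - v) ^ (2 * k + 1)) * gb * (X + C u) ^ k, ?_⟩
      rw [mul_pow (u - v), C_mul]
      have hF' := hF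
      linear_combination ((X + C (u - v)) ^ (k + 1) * (X + C (u - w)) ^ (k + 1)) * hdiv
        + (Qb * (X + C (u - w)) ^ (k + 1)) * (X + C u) ^ k * hga
        + C ((u - v) ^ (2 * k + 1)) * (X + C u) ^ k * hgb
        + ((X + C (u - v)) ^ (k + 1) * (X + C (u - w)) ^ (k + 1)) * hF'
    obtain ⟨g, hg⟩ := key
    have h := congrArg (fun P : K[X] => P.comp (X - C u)) hg
    simp only [mul_comp, sub_comp, add_comp, pow_comp, X_comp, C_comp] at h
    refine ⟨g.comp (X - C u), ?_⟩
    rw [← h]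
    simp only [C_sub]
    rw [show (X - C u + (C u - C v) : K[X]) = X - C v by ring,
      show (X - C u + (C u - C w) : K[X]) = X - C w by ring,
      show (X - C u + C u : K[X]) = X by ring]

lemma coeff_top {K : Type*} [Field K] (k : ℕ) (G : K[X]) (v w : K) (h : G.natDegree ≤ k) :
    (G * (X - C v) ^ (k + 1) * (X - C w) ^ (k + 1)).coeff (3 * k + 2) = G.coeff k ∧
    (G * (X - C v) ^ (k + 1) * (X - C w) ^ (k + 1)).natDegree ≤ 3 * k + 2 := by
  have hm : ∀ x : K, ((X - C x) ^ (k + 1)).natDegree = k + 1 := by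
    intro x; rw [natDegree_pow, natDegree_X_sub_C, mul_one]
  have hc : ∀ x : K, ((X - C x) ^ (k + 1)).coeff (k + 1) = 1 := by
    intro x
    have := ((monic_X_sub_C x).pow (k + 1)).coeff_natDegree
    rwa [hm] at this
  have h1 : (G * (X - C v) ^ (k + 1)).natDegree ≤ k + (k + 1) :=
    natDegree_mul_le_of_le h (hm v).le
  constructor
  · rw [show 3 * k + 2 = (k + (k + 1)) + (k + 1) by ring,
      coeff_mul_add_eq_of_natDegree_le h1 (hm w).le, coeff_mul_add_eq_of_natDegree_le h (hm v).le, hc, hc]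
    simp
  · have := natDegree_mul_le_of_le h1 (hm w).le
    omega

lemma syz_field {K : Type*} [Field K] (k : ℕ) (u v w : K) (huv : u ≠ v) (hvw : v ≠ w)
    (hwu : w ≠ u) :
    (w - v) ^ (2 * k + 1) * fff k u (u - v) (u - w)
    + (u - w) ^ (2 * k + 1) * fff k v (v - w) (v - u)
    + (v - u) ^ (2 * k + 1) * fff k w (w - u) (w - v) = 0 := by
  obtain ⟨G1, d1, c1, g1, h1⟩ := exists_G k u v w (sub_ne_zero.2 huv) (sub_ne_zero.2 hwu.symm)
  obtain ⟨G2, d2, c2, g2, h2⟩ := exists_G k v w u (sub_ne_zero.2 hvw) (sub_ne_zero.2 huv.symm)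
  obtain ⟨G3, d3, c3, g3, h3⟩ := exists_G k w u v (sub_ne_zero.2 hwu) (sub_ne_zero.2 hvw.symm)
  obtain ⟨t1, b1⟩ := coeff_top k G1 v w d1
  obtain ⟨t2, b2⟩ := coeff_top k G2 w u d2
  obtain ⟨t3, b3⟩ := coeff_top k G3 u v d3
  set F1 := G1 * (X - C v) ^ (k + 1) * (X - C w) ^ (k + 1) with hF1
  set F2 := G2 * (X - C w) ^ (k + 1) * (X - C u) ^ (k + 1) with hF2
  set F3 := G3 * (X - C u) ^ (k + 1) * (X - C v) ^ (k + 1) with hF3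
  set n := 2 * k + 1 with hn
  set M : K[X] := C ((w - v) ^ n) * F1 + C ((u - w) ^ n) * F2 + C ((v - u) ^ n) * F3
    - C (((u - v) * (v - w) * (w - u)) ^ n) * X ^ k with hM
  have D1 : (X - C u) ^ (k + 1) ∣ M := by
    refine ⟨C ((w - v) ^ n) * g1 + C ((u - w) ^ n) * (G2 * (X - C w) ^ (k + 1))
      + C ((v - u) ^ n) * (G3 * (X - C v) ^ (k + 1)), ?_⟩
    have : ((u - v) * (v - w) * (w - u)) ^ n = (w - v) ^ n * ((u - v) * (u - w)) ^ n := by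
      rw [← mul_pow]; congr 1; ring
    rw [hM, this, C_mul]
    linear_combination C ((w - v) ^ n) * h1 + C ((u - w) ^ n) * hF2 + C ((v - u) ^ n) * hF3
  have D2 : (X - C v) ^ (k + 1) ∣ M := by
    refine ⟨C ((u - w) ^ n) * g2 + C ((w - v) ^ n) * (G1 * (X - C w) ^ (k + 1))
      + C ((v - u) ^ n) * (G3 * (X - C u) ^ (k + 1)), ?_⟩
    have : ((u - v) * (v - w) * (w - u)) ^ n = (u - w) ^ n * ((v - w) * (v - u)) ^ n := by
      rw [← mul_pow]; congr 1; ring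
    rw [hM, this, C_mul]
    linear_combination C ((u - w) ^ n) * h2 + C ((w - v) ^ n) * hF1 + C ((v - u) ^ n) * hF3
  have D3 : (X - C w) ^ (k + 1) ∣ M := by
    refine ⟨C ((v - u) ^ n) * g3 + C ((w - v) ^ n) * (G1 * (X - C v) ^ (k + 1))
      + C ((u - w) ^ n) * (G2 * (X - C u) ^ (k + 1)), ?_⟩
    have : ((u - v) * (v - w) * (w - u)) ^ n = (v - u) ^ n * ((w - u) * (w - v)) ^ n := by
      rw [← mul_pow]; congr 1; ring
    rw [hM, this, C_mul]
    linear_combination C ((v - u) ^ n) * h3 + C ((w - v) ^ n) * hF1 + C ((u - w) ^ n) * hF2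
  have cop : ∀ x y : K, x ≠ y → IsCoprime ((X - C x) ^ (k + 1)) ((X - C y) ^ (k + 1)) := by
    intro x y h
    exact (isCoprime_X_sub_C_of_isUnit_sub (sub_ne_zero.2 h).isUnit).pow
  have D : ((X - C u) ^ (k + 1) * (X - C v) ^ (k + 1)) * (X - C w) ^ (k + 1) ∣ M :=
    IsCoprime.mul_dvd (IsCoprime.mul_left (cop u w hwu.symm) (cop v w hvw))
      ((cop u v huv).mul_dvd D1 D2) D3
  have hmon : (((X - C u) ^ (k + 1) * (X - C v) ^ (k + 1)) * (X - C w) ^ (k + 1)).Monic :=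
    (((monic_X_sub_C u).pow _).mul ((monic_X_sub_C v).pow _)).mul ((monic_X_sub_C w).pow _)
  have hdeg : (((X - C u) ^ (k + 1) * (X - C v) ^ (k + 1)) * (X - C w) ^ (k + 1)).natDegree
      = 3 * k + 3 := by
    rw [(((monic_X_sub_C u).pow _).mul ((monic_X_sub_C v).pow _)).natDegree_mul
      ((monic_X_sub_C w).pow _), ((monic_X_sub_C u).pow _).natDegree_mul ((monic_X_sub_C v).pow _)]
    simp only [natDegree_pow, natDegree_X_sub_C]
    ring
  have hMd : M.natDegree ≤ 3 * k + 2 := by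
    rw [hM]
    refine natDegree_sub_le_of_le (natDegree_add_le_of_degree_le (natDegree_add_le_of_degree_le
      ((natDegree_C_mul_le _ _).trans b1) ((natDegree_C_mul_le _ _).trans b2))
      ((natDegree_C_mul_le _ _).trans b3)) ?_ |>.trans (max_self _).le
    exact (natDegree_C_mul_X_pow_le _ _).trans (by omega)
  have hM0 : M = 0 := by
    by_contra hne
    have := natDegree_le_of_dvd D hne
    omega
  have hc := congrArg (fun P : K[X] => P.coeff (3 * k + 2)) hM0
  simp only [hM, coeff_sub, coeff_add, coeff_C_mul, coeff_X_pow, coeff_zero] at hc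
  rw [t1, t2, t3, c1, c2, c3, if_neg (by omega)] at hc
  linear_combination hc
end

lemma fin_alg {R : Type*} [CommRing R] [IsDomain R] [CharZero R] (p : ℕ) (hp : p.Prime) (q k : ℕ)
    (A B H r1 r2 r3 : R) (hH : (p : R) * H = (A + B) ^ q + (-A) ^ q + (-B) ^ q)
    (syz : (A + B) ^ (q + k) * ((A * -B) ^ k + p * r1)
      + (-B) ^ (q + k) * ((-(A + B) * -A) ^ k + p * r2)
      + (-A) ^ (q + k) * ((B * (A + B)) ^ k + p * r3) = 0) :
    H * ((A + B) * A * B) ^ k =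
      (A + B) ^ (q + k) * (-(-1) ^ k * r1) + A ^ (q + k) * (-(-1) ^ k * (-1) ^ (q + k) * r3)
        + B ^ (q + k) * (-(-1) ^ k * (-1) ^ (q + k) * r2) := by
  have hsq : ((-1 : R) ^ k) * (-1) ^ k = 1 := by
    rw [← mul_pow]; simp
  have hp0 : (p : R) ≠ 0 := Nat.cast_ne_zero.2 hp.ne_zero
  apply mul_left_cancel₀ hp0
  rw [neg_pow A (q + k), neg_pow B (q + k)] at syz
  rw [neg_pow A q, neg_pow B q] at hH
  rw [show A * -B = (-1) * (A * B) by ring, show -(A + B) * -A = (A + B) * A by ring] at syz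
  simp only [mul_pow, pow_add (-1 : R), pow_add A, pow_add B,
    pow_add (A + B)] at syz ⊢
  generalize (A + B) ^ k = Ck at *
  generalize (A + B) ^ q = Cq at *
  generalize A ^ k = Ak at *
  generalize A ^ q = Aq at *
  generalize B ^ k = Bk at *
  generalize B ^ q = Bq at *
  generalize (-1 : R) ^ k = s at *
  generalize (-1 : R) ^ q = t at *
  linear_combination (Ck * Ak * Bk) * hH + s * syz
    - (Ck * Ak * Bk) * (Cq + t * Aq + t * Bq) * hsq

lemma main_aux {R : Type*} [CommRing R] [IsDomain R] [CharZero R] (p : ℕ) (hp : p.Prime) (e : ℕ)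
    (q : ℕ) (hq : q = p ^ e) (k : ℕ) (hk : k = q - 1) (A B T : R) (hA : A ≠ 0) (hB : B ≠ 0)
    (hC : A + B ≠ 0) :
    ∃ H : R,
      (p : R) * H = (A + B) ^ q + (-A) ^ q + (-B) ^ q ∧
      H * ((A + B) * A * B) ^ k ∈
        Ideal.span {(A + B) ^ (q + k)} * (Ideal.span {T, A}) ^ k * (Ideal.span {T, B}) ^ k
          + Ideal.span {A ^ (q + k)} * (Ideal.span {T, B}) ^ k
              * (Ideal.span {T + B, A + B}) ^ k
          + Ideal.span {B ^ (q + k)} * (Ideal.span {T, A}) ^ k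
              * (Ideal.span {T - A, A + B}) ^ k := by
  have hqpos : 0 < q := by rw [hq]; exact pow_pos hp.pos _
  have hk1 : k + 1 = p ^ e := by omega
  have hH : ∃ H : R,
      (p : R) * H = (A + B) ^ q + (-A) ^ q + (-B) ^ q := by
    obtain ⟨r1, h1⟩ := exists_add_pow_prime_pow_eq hp A B e
    obtain ⟨r2, h2⟩ := exists_add_pow_prime_pow_eq hp A (-A) e
    obtain ⟨r3, h3⟩ := exists_add_pow_prime_pow_eq hp B (-B) e
    rw [← hq] at h1 h2 h3
    rw [add_neg_cancel, zero_pow hqpos.ne'] at h2 h3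
    refine ⟨A * B * r1 - A * (-A) * r2 - B * (-B) * r3, ?_⟩
    linear_combination -h1 + h2 + h3
  obtain ⟨H, hH⟩ := hH
  refine ⟨H, hH, ?_⟩
  have syz : (A + B) ^ (q + k) * fff k T A (-B) + (-B) ^ (q + k) * fff k (T - A) (-(A + B)) (-A)
      + (-A) ^ (q + k) * fff k (T + B) B (A + B) = 0 := by
    set φ := algebraMap (R) (FractionRing (R)) with hφ
    have hinj : Function.Injective φ := IsFractionRing.injective _ _
    have hne : ∀ x y, x - y ≠ 0 → φ x ≠ φ y := fun x y h h' => h (sub_eq_zero.2 (hinj h'))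
    apply hinj
    have := syz_field k (φ T) (φ (T - A)) (φ (T + B))
      (hne _ _ (by rwa [show T - (T - A) = A by ring]))
      (hne _ _ (by rw [show T - A - (T + B) = -(A + B) by ring]; exact neg_ne_zero.2 hC))
      (hne _ _ (by rwa [show T + B - T = B by ring]))
    simp only [← map_sub, ← fff_map, ← map_pow, ← map_mul, ← map_add] at this
    rw [map_zero, ← this, show q + k = 2 * k + 1 by omega]
    congr 1
    rw [show T - (T - A) = A by ring, show T - (T + B) = -B by ring,
      show T + B - (T - A) = A + B by ring, show T - A - (T + B) = -(A + B) by ring,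
      show T - A - T = -A by ring, show T + B - T = B by ring]
  obtain ⟨r1, hr1, f1⟩ := fff_mod p hp e k hk1 T A (-B) (Ideal.span {T, A}) (Ideal.span {T, B})
    (Ideal.subset_span (by simp)) (Ideal.subset_span (by simp)) (Ideal.subset_span (by simp))
    (Ideal.neg_mem_iff _ |>.2 (Ideal.subset_span (by simp)))
  obtain ⟨r2, hr2, f2⟩ := fff_mod p hp e k hk1 (T - A) (-(A + B)) (-A)
    (Ideal.span {T - A, A + B}) (Ideal.span {T, A})
    (Ideal.subset_span (by simp)) (Ideal.neg_mem_iff _ |>.2 (Ideal.subset_span (by simp)))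
    (Ideal.sub_mem _ (Ideal.subset_span (by simp)) (Ideal.subset_span (by simp)))
    (Ideal.neg_mem_iff _ |>.2 (Ideal.subset_span (by simp)))
  obtain ⟨r3, hr3, f3⟩ := fff_mod p hp e k hk1 (T + B) B (A + B)
    (Ideal.span {T, B}) (Ideal.span {T + B, A + B})
    (Ideal.add_mem _ (Ideal.subset_span (by simp)) (Ideal.subset_span (by simp)))
    (Ideal.subset_span (by simp)) (Ideal.subset_span (by simp)) (Ideal.subset_span (by simp))
  rw [f1, f2, f3] at syz
  have hfin := fin_alg p hp q k A B H r1 r2 r3 hH syz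
  rw [hfin]
  refine Submodule.add_mem_sup (Submodule.add_mem_sup ?_ ?_) ?_
  · rw [mul_assoc]
    exact Ideal.mul_mem_mul (Ideal.mem_span_singleton_self _) (Ideal.mul_mem_left _ _ hr1)
  · rw [mul_assoc]
    exact Ideal.mul_mem_mul (Ideal.mem_span_singleton_self _) (Ideal.mul_mem_left _ _ hr3)
  · rw [mul_assoc, mul_comm (Ideal.span {T, A} ^ k)]
    exact Ideal.mul_mem_mul (Ideal.mem_span_singleton_self _) (Ideal.mul_mem_left _ _ hr2)

open MvPolynomial

theorem stmt_13 (p : ℕ) (hp : p.Prime) (e : ℕ) (he : 1 ≤ e) (q : ℕ) (hq : q = p ^ e)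
    (k : ℕ) (hk : k = q - 1) :
    let A : MvPolynomial (Fin 3) ℤ := X 0
    let B : MvPolynomial (Fin 3) ℤ := X 1
    let T : MvPolynomial (Fin 3) ℤ := X 2
    ∃ H : MvPolynomial (Fin 3) ℤ,
      (p : MvPolynomial (Fin 3) ℤ) * H = (A + B) ^ q + (-A) ^ q + (-B) ^ q ∧
      H * ((A + B) * A * B) ^ k ∈
        Ideal.span {(A + B) ^ (q + k)} * (Ideal.span {T, A}) ^ k * (Ideal.span {T, B}) ^ k
          + Ideal.span {A ^ (q + k)} * (Ideal.span {T, B}) ^ k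
              * (Ideal.span {T + B, A + B}) ^ k
          + Ideal.span {B ^ (q + k)} * (Ideal.span {T, A}) ^ k
              * (Ideal.span {T - A, A + B}) ^ k := by
  intro A B T
  have hA : A ≠ 0 := X_ne_zero 0
  have hB : B ≠ 0 := X_ne_zero 1
  have hC : A + B ≠ 0 := by
    intro h
    have := congrArg (MvPolynomial.eval (fun _ => (1 : ℤ))) h
    simp [A, B] at this
  exact main_aux p hp e q hq k hk A B T hA hB hC
end

section
/- Let R = ℤ[s,t,u,v,w,x,y,z], p a prime, q = p^e, k = q-1. Then (1/p)·[(vz-wy)^q(ut-xs)^q + (wx-uz)^q(vt-ys)^q + (uy-vx)^q(wt-zs)^q] · [(ut-xs)(vt-ys)(wt-zs)]^k lies in the ideal ((ut-xs)^{q+k}, (vt-ys)^{q+k}, (wt-zs)^{q+k})R. -/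
open MvPolynomial

lemma frob_aux {R : Type*} [CommRing R] (p e : ℕ) (hp : p.Prime) (x y : R) :
    ∃ g : R, (x + y) ^ (p ^ e) = x ^ (p ^ e) + y ^ (p ^ e) + p * g :=
  ⟨_, add_pow_prime_pow_eq' hp x y e⟩

/-- The representation `a ^ (2q-1) = t ^ q P + s ^ q Q` with `P`, `Q` known modulo `p`. -/
lemma PQ_aux {R : Type*} [CommRing R] (p e k : ℕ) (hp : p.Prime) (hk : p ^ e = k + 1)
    (s t u x : R) :
    ∃ G L : R, (u * t - x * s) ^ (p ^ e + k) =
      t ^ (p ^ e) * (u ^ (p ^ e) * (u * t - x * s) ^ k + p * G) +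
      s ^ (p ^ e) * ((-x) ^ (p ^ e) * (u * t - x * s) ^ k + p * L) := by
  have h := add_pow_prime_pow_eq' hp (u * t) (-x * s) e
  have ha : u * t + -x * s = u * t - x * s := by ring
  have hmem : (∑ i ∈ Finset.Ioo 0 (p ^ e), (u * t) ^ i * (-x * s) ^ (p ^ e - i) *
      (((p ^ e).choose i / p : ℕ) : R)) * (u * t - x * s) ^ k ∈
      Ideal.span {t ^ (p ^ e), s ^ (p ^ e)} := by
    rw [← ha, add_pow, Finset.sum_mul_sum]
    refine Ideal.sum_mem _ fun i hi => Ideal.sum_mem _ fun j hj => ?_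
    rw [Finset.mem_Ioo] at hi
    rw [Finset.mem_range] at hj
    rw [Ideal.mem_span_pair]
    by_cases hij : p ^ e ≤ i + j
    · obtain ⟨d, hd⟩ := Nat.exists_eq_add_of_le hij
      refine ⟨t ^ d * (u ^ i * u ^ j * (-x * s) ^ (p ^ e - i) *
        (((p ^ e).choose i / p : ℕ) : R) * (-x * s) ^ (k - j) * (k.choose j : R)), 0, ?_⟩
      have : t ^ i * t ^ j = t ^ (p ^ e) * t ^ d := by rw [← pow_add, ← pow_add, hd]
      rw [mul_pow u t i, mul_pow u t j]
      linear_combination (-(u ^ i * u ^ j * (-x * s) ^ (p ^ e - i) *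
        (((p ^ e).choose i / p : ℕ) : R) * (-x * s) ^ (k - j) * (k.choose j : R))) * this
    · obtain ⟨d, hd⟩ : ∃ d, (p ^ e - i) + (k - j) = p ^ e + d :=
        Nat.exists_eq_add_of_le (by omega)
      refine ⟨0, s ^ d * ((-x) ^ (p ^ e - i) * (-x) ^ (k - j) * (u * t) ^ i * (u * t) ^ j *
        (((p ^ e).choose i / p : ℕ) : R) * (k.choose j : R)), ?_⟩
      have : s ^ (p ^ e - i) * s ^ (k - j) = s ^ (p ^ e) * s ^ d := by
        rw [← pow_add, ← pow_add, hd]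
      rw [mul_pow (-x) s (p ^ e - i), mul_pow (-x) s (k - j)]
      linear_combination (-((-x) ^ (p ^ e - i) * (-x) ^ (k - j) * (u * t) ^ i * (u * t) ^ j *
        (((p ^ e).choose i / p : ℕ) : R) * (k.choose j : R))) * this
  obtain ⟨G, L, hGL⟩ := Ideal.mem_span_pair.mp hmem
  refine ⟨G, L, ?_⟩
  rw [ha] at h
  rw [mul_pow, mul_pow] at h
  rw [pow_add]
  generalize (∑ i ∈ Finset.Ioo 0 (p ^ e), (u * t) ^ i * (-x * s) ^ (p ^ e - i) *
      (((p ^ e).choose i / p : ℕ) : R)) = S at h hGL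
  generalize u * t - x * s = a at *
  linear_combination a ^ k * h - (p : R) * hGL

/-- `(vz-wy)^q (bc)^k` agrees modulo `p` with `Q_v P_w - Q_w P_v`. -/
lemma minor_aux {R : Type*} [CommRing R] (p e k : ℕ) (hp : p.Prime)
    (v w y z b c Gv Lv Gw Lw : R) :
    ∃ α : R, (v * z - w * y) ^ (p ^ e) * (b * c) ^ k =
      ((-y) ^ (p ^ e) * b ^ k + p * Lv) * (w ^ (p ^ e) * c ^ k + p * Gw) -
      ((-z) ^ (p ^ e) * c ^ k + p * Lw) * (v ^ (p ^ e) * b ^ k + p * Gv) + p * α := by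
  obtain ⟨g, hg⟩ := frob_aux p e hp (v * z) (w * -y)
  obtain ⟨g', hg'⟩ := frob_aux p e hp z (-z)
  have h0 : p ^ e ≠ 0 := pow_ne_zero _ hp.ne_zero
  rw [add_neg_cancel, zero_pow h0] at hg'
  rw [show v * z + w * -y = v * z - w * y by ring, mul_pow, mul_pow] at hg
  rw [mul_pow b c]
  generalize (v * z - w * y) ^ (p ^ e) = A at *
  generalize (-z) ^ (p ^ e) = z1 at *
  generalize (-y) ^ (p ^ e) = y1 at *
  generalize z ^ (p ^ e) = z0 at *
  generalize v ^ (p ^ e) = v0 at *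
  generalize w ^ (p ^ e) = w0 at *
  generalize b ^ k = b0 at *
  generalize c ^ k = c0 at *
  refine ⟨b0 * c0 * g - v0 * b0 * c0 * g' - (y1 * b0 * Gw + Lv * (w0 * c0 + p * Gw)) +
    (z1 * c0 * Gv + Lw * (v0 * b0 + p * Gv)), ?_⟩
  linear_combination b0 * c0 * hg - v0 * b0 * c0 * hg'

theorem stmt_15 (p : ℕ) (hp : p.Prime) (e : ℕ) (he : 1 ≤ e) (q : ℕ) (hq : q = p ^ e)
    (k : ℕ) (hk : k = q - 1) :
    let R := MvPolynomial (Fin 8) ℤ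
    let s : R := X 0; let t : R := X 1; let u : R := X 2; let v : R := X 3
    let w : R := X 4; let x : R := X 5; let y : R := X 6; let z : R := X 7
    ∃ H : R,
      (p : R) * H = (v * z - w * y) ^ q * (u * t - x * s) ^ q
          + (w * x - u * z) ^ q * (v * t - y * s) ^ q
          + (u * y - v * x) ^ q * (w * t - z * s) ^ q ∧
      H * ((u * t - x * s) * (v * t - y * s) * (w * t - z * s)) ^ k ∈
        Ideal.span {(u * t - x * s) ^ (q + k), (v * t - y * s) ^ (q + k),
          (w * t - z * s) ^ (q + k)} := by
  intro R s t u v w x y z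
  have hq0 : p ^ e ≠ 0 := pow_ne_zero _ hp.ne_zero
  have hk1 : p ^ e = k + 1 := by omega
  have hp0 : (p : R) ≠ 0 := Nat.cast_ne_zero.mpr hp.ne_zero
  subst hq
  clear_value s t u v w x y z
  obtain ⟨Gu, Lu, hu⟩ := PQ_aux p e k hp hk1 s t u x
  obtain ⟨Gv, Lv, hv⟩ := PQ_aux p e k hp hk1 s t v y
  obtain ⟨Gw, Lw, hw⟩ := PQ_aux p e k hp hk1 s t w z
  obtain ⟨α, hα⟩ := minor_aux p e k hp v w y z (v * t - y * s) (w * t - z * s) Gv Lv Gw Lw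
  obtain ⟨β, hβ⟩ := minor_aux p e k hp w u z x (w * t - z * s) (u * t - x * s) Gw Lw Gu Lu
  obtain ⟨γ, hγ⟩ := minor_aux p e k hp u v x y (u * t - x * s) (v * t - y * s) Gu Lu Gv Lv
  obtain ⟨g1, h1⟩ := frob_aux p e hp ((v * z - w * y) * (u * t - x * s))
    ((w * x - u * z) * (v * t - y * s))
  obtain ⟨g2, h2⟩ := frob_aux p e hp ((v * z - w * y) * (u * t - x * s) +
    (w * x - u * z) * (v * t - y * s)) ((u * y - v * x) * (w * t - z * s))
  rw [show (v * z - w * y) * (u * t - x * s) + (w * x - u * z) * (v * t - y * s) +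
    (u * y - v * x) * (w * t - z * s) = 0 by ring, zero_pow hq0, h1, mul_pow, mul_pow,
    mul_pow] at h2
  have hH : (p : R) * (-g1 - g2) = (v * z - w * y) ^ (p ^ e) * (u * t - x * s) ^ (p ^ e)
          + (w * x - u * z) ^ (p ^ e) * (v * t - y * s) ^ (p ^ e)
          + (u * y - v * x) ^ (p ^ e) * (w * t - z * s) ^ (p ^ e) := by
    linear_combination h2
  refine ⟨-g1 - g2, hH, ?_⟩
  clear h1 h2
  generalize -g1 - g2 = H at *
  have key : H * ((u * t - x * s) * (v * t - y * s) * (w * t - z * s)) ^ k =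
      α * (u * t - x * s) ^ (p ^ e + k) + (β * (v * t - y * s) ^ (p ^ e + k) +
        γ * (w * t - z * s) ^ (p ^ e + k)) := by
    apply mul_left_cancel₀ hp0
    generalize u * t - x * s = a at *
    generalize v * t - y * s = b at *
    generalize w * t - z * s = c at *
    generalize (v * z - w * y) ^ (p ^ e) = A at *
    generalize (w * x - u * z) ^ (p ^ e) = B at *
    generalize (u * y - v * x) ^ (p ^ e) = C at *
    generalize u ^ (p ^ e) * a ^ k + p * Gu = Pu at *
    generalize v ^ (p ^ e) * b ^ k + p * Gv = Pv at *
    generalize w ^ (p ^ e) * c ^ k + p * Gw = Pw at *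
    generalize (-x) ^ (p ^ e) * a ^ k + p * Lu = Qu at *
    generalize (-y) ^ (p ^ e) * b ^ k + p * Lv = Qv at *
    generalize (-z) ^ (p ^ e) * c ^ k + p * Lw = Qw at *
    rw [pow_add] at hu hv hw
    rw [mul_pow] at hα hβ hγ
    simp only [pow_add, mul_pow]
    generalize a ^ (p ^ e) = a1 at *
    generalize b ^ (p ^ e) = b1 at *
    generalize c ^ (p ^ e) = c1 at *
    generalize s ^ (p ^ e) = s1 at *
    generalize t ^ (p ^ e) = t1 at *
    generalize a ^ k = a0 at *
    generalize b ^ k = b0 at *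
    generalize c ^ k = c0 at *
    linear_combination a0 * b0 * c0 * hH + a1 * a0 * hα + b1 * b0 * hβ + c1 * c0 * hγ +
      (Qv * Pw - Qw * Pv) * hu + (Qw * Pu - Qu * Pw) * hv + (Qu * Pv - Qv * Pu) * hw
  rw [key]
  refine Ideal.add_mem _ (Ideal.mul_mem_left _ _ (Ideal.subset_span (by simp)))
    (Ideal.add_mem _ (Ideal.mul_mem_left _ _ (Ideal.subset_span (by simp)))
      (Ideal.mul_mem_left _ _ (Ideal.subset_span (by simp))))
end

section
/- Let p be a prime, q = p^e, k = q-1, and d an integer with d ≡ 1 mod p such that cᵣ := d·q/(2q-1-r) ∈ ℤ for 0 ≤ r ≤ k. Then in R = ℤ[s,t,u,v,w,x,y,z] the following identity holds: ∑_{r=0}^{k} ∑_{n=0}^{r} cᵣ·C(2k+1-r,n)·C(k-n,r-n)·(st)^{k-r}·[ (ut-xs)^{2k+1}(wy)^n(vz-wy)^{2k+1-r-n}(vt-ys)^r(wt-zs)^r + (vt-ys)^{2k+1}(uz)^n(wx-uz)^{2k+1-r-n}(wt-zs)^r(ut-xs)^r + (wt-zs)^{2k+1}(vx)^n(uy-vx)^{2k+1-r-n}(ut-xs)^r(vt-ys)^r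 ] = 0. -/
open MvPolynomial

namespace Aux16

/-- truncated logarithm series -/
noncomputable def S {K : Type*} [Field K] (N : ℕ) (w : PowerSeries K) : PowerSeries K :=
  ∑ m ∈ Finset.range N, PowerSeries.C (((m : K) + 1)⁻¹) * w ^ (m + 1)

lemma S_deriv {K : Type*} [Field K] [CharZero K] (N : ℕ) (w : PowerSeries K) :
    (1 - w) * PowerSeries.derivative K (S N w)
      = PowerSeries.derivative K w * (1 - w ^ N) := by
  induction N with
  | zero => simp [S]
  | succ N ih =>
    have h1 : S (N + 1) w = S N w + PowerSeries.C (((N : K) + 1)⁻¹) * w ^ (N + 1) := by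
      simp [S, Finset.sum_range_succ]
    have h2 : PowerSeries.derivative K (PowerSeries.C (((N : K) + 1)⁻¹) * w ^ (N + 1))
        = w ^ N * PowerSeries.derivative K w := by
      have hN : (N : K) + 1 ≠ 0 := by exact_mod_cast Nat.succ_ne_zero N
      have h3 : PowerSeries.C (((N : K) + 1)⁻¹) * ((N : PowerSeries K) + 1) = 1 := by
        have : ((N : PowerSeries K) + 1) = PowerSeries.C ((N : K) + 1) := by simp
        rw [this, ← map_mul, inv_mul_cancel₀ hN, map_one]
      rw [Derivation.leibniz, Derivation.leibniz_pow]
      simp only [PowerSeries.derivative_C, smul_eq_mul, nsmul_eq_mul, Nat.add_sub_cancel]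
      push_cast
      linear_combination (w ^ N * PowerSeries.derivative K w) * h3
    rw [h1, map_add, h2, mul_add, ih]
    ring

lemma S_const {K : Type*} [Field K] (N : ℕ) (w : PowerSeries K)
    (hw : PowerSeries.X ∣ w) : PowerSeries.X ∣ S N w := by
  refine Finset.dvd_sum fun m _ => Dvd.dvd.mul_left (dvd_pow hw (by omega)) _

lemma dvd_of_deriv {K : Type*} [Field K] [CharZero K] (N : ℕ) (D : PowerSeries K)
    (h0 : PowerSeries.X ∣ D) (h : PowerSeries.X ^ N ∣ PowerSeries.derivative K D) :
    PowerSeries.X ^ (N + 1) ∣ D := by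
  rw [PowerSeries.X_pow_dvd_iff] at h ⊢
  intro m hm
  rcases m with _ | m
  · rw [PowerSeries.X_dvd_iff] at h0
    simpa using h0
  · have := h m (by omega)
    rw [PowerSeries.coeff_derivative] at this
    have hN : (m : K) + 1 ≠ 0 := by exact_mod_cast Nat.succ_ne_zero m
    exact (mul_eq_zero.mp this).resolve_right hN

lemma S_add {K : Type*} [Field K] [CharZero K] (N : ℕ) (p q : PowerSeries K)
    (hp : PowerSeries.X ∣ p) (hq : PowerSeries.X ∣ q) :
    PowerSeries.X ^ (N + 1) ∣ S N p + S N q - S N (p + q - p * q) := by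
  have hr : PowerSeries.X ∣ p + q - p * q :=
    dvd_sub (dvd_add hp hq) (Dvd.dvd.mul_right hp _)
  apply dvd_of_deriv
  · exact dvd_sub (dvd_add (S_const N p hp) (S_const N q hq)) (S_const N _ hr)
  · have hu : IsUnit (1 - (p + q - p * q)) := by
      rw [PowerSeries.isUnit_iff_constantCoeff]
      rw [PowerSeries.X_dvd_iff] at hr
      rw [map_sub, hr]; simp
    rw [← hu.dvd_mul_left]
    have e1 := S_deriv N p
    have e2 := S_deriv N q
    have e3 := S_deriv N (p + q - p * q)
    have e4 : PowerSeries.derivative K (p + q - p * q)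
        = PowerSeries.derivative K p * (1 - q) + PowerSeries.derivative K q * (1 - p) := by
      simp only [map_sub, map_add, Derivation.leibniz, smul_eq_mul]; ring
    have key : (1 - (p + q - p * q)) *
        PowerSeries.derivative K (S N p + S N q - S N (p + q - p * q))
        = p ^ N * (-(1 - q) * PowerSeries.derivative K p)
          + q ^ N * (-(1 - p) * PowerSeries.derivative K q)
          + (p + q - p * q) ^ N * PowerSeries.derivative K (p + q - p * q) := by
      rw [map_sub, map_add]
      linear_combination (1 - q) * e1 + (1 - p) * e2 - e3 - e4
    rw [key]
    exact dvd_add (dvd_add (Dvd.dvd.mul_right (pow_dvd_pow_of_dvd hp N) _)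
      (Dvd.dvd.mul_right (pow_dvd_pow_of_dvd hq N) _))
      (Dvd.dvd.mul_right (pow_dvd_pow_of_dvd hr N) _)

lemma S_add3 {K : Type*} [Field K] [CharZero K] (N : ℕ) (p q r p' q' r' : PowerSeries K)
    (hp : PowerSeries.X ∣ p) (hq : PowerSeries.X ∣ q) (hr : PowerSeries.X ∣ r)
    (hp' : PowerSeries.X ∣ p') (hq' : PowerSeries.X ∣ q') (hr' : PowerSeries.X ∣ r')
    (h : (1 - p) * (1 - q) * (1 - r) = (1 - p') * (1 - q') * (1 - r')) :
    PowerSeries.X ^ (N + 1) ∣ (S N p + S N q + S N r) - (S N p' + S N q' + S N r') := by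
  have hpq : PowerSeries.X ∣ p + q - p * q :=
    dvd_sub (dvd_add hp hq) (Dvd.dvd.mul_right hp _)
  have hpq' : PowerSeries.X ∣ p' + q' - p' * q' :=
    dvd_sub (dvd_add hp' hq') (Dvd.dvd.mul_right hp' _)
  have h1 := S_add N p q hp hq
  have h2 := S_add N _ r hpq hr
  have h1' := S_add N p' q' hp' hq'
  have h2' := S_add N _ r' hpq' hr'
  have e : p' + q' - p' * q' + r' - (p' + q' - p' * q') * r'
      = p + q - p * q + r - (p + q - p * q) * r := by linear_combination h
  rw [e] at h2'
  have := dvd_sub (dvd_add h1 h2) (dvd_add h1' h2')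
  convert this using 1
  ring

/-- the series `1/(1-X)` -/
noncomputable def G (K : Type*) [Field K] : PowerSeries K := PowerSeries.mk 1

lemma G_mul (K : Type*) [Field K] : G K * (1 - PowerSeries.X) = 1 :=
  PowerSeries.mk_one_mul_one_sub_eq_one K

noncomputable def W {K : Type*} [Field K] (α β : K) : PowerSeries K :=
  PowerSeries.X * ((PowerSeries.C α + PowerSeries.X * PowerSeries.C β) * G K)

noncomputable def f {K : Type*} [Field K] (k : ℕ) (α β : K) : K :=
  ∑ r ∈ Finset.range (k + 1), ∑ n ∈ Finset.range (r + 1),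
    (((2 * k + 1 - r : ℕ) : K))⁻¹ * (Nat.choose (2 * k + 1 - r) n : K)
      * (Nat.choose (k - n) (r - n) : K) * (β ^ n * α ^ (2 * k + 1 - r - n))

lemma coeff_small {K : Type*} [Field K] (k m : ℕ) (hm : m ≤ k) (α β : K) :
    PowerSeries.coeff (2 * k + 1) ((1 - PowerSeries.X) ^ k * W α β ^ m) = 0 := by
  have h : (1 - PowerSeries.X) ^ k * W α β ^ m
      = (((1 - Polynomial.X) ^ (k - m) * (Polynomial.X * (Polynomial.C α
          + Polynomial.X * Polynomial.C β)) ^ m : Polynomial K) : PowerSeries K) := by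
    obtain ⟨j, rfl⟩ := Nat.exists_eq_add_of_le hm
    push_cast
    rw [Nat.add_sub_cancel_left, pow_add, W]
    have := congrArg (· ^ m) (G_mul K)
    simp only [mul_pow, one_pow] at this ⊢
    linear_combination ((1 - PowerSeries.X) ^ j * PowerSeries.X ^ m *
      (PowerSeries.C α + PowerSeries.X * PowerSeries.C β) ^ m) * this
  rw [h, Polynomial.coeff_coe]
  apply Polynomial.coeff_eq_zero_of_natDegree_lt
  have : ((1 - Polynomial.X) ^ (k - m) * (Polynomial.X * (Polynomial.C α
          + Polynomial.X * Polynomial.C β)) ^ m : Polynomial K).natDegree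
      ≤ (k - m) * 1 + m * 2 := by
    apply Polynomial.natDegree_mul_le_of_le
    · apply Polynomial.natDegree_pow_le_of_le
      compute_degree
    · apply Polynomial.natDegree_pow_le_of_le
      compute_degree
  omega

lemma coeff_big {K : Type*} [Field K] (k r : ℕ) (hr : r ≤ k) (α β : K) :
    PowerSeries.coeff (2 * k + 1) ((1 - PowerSeries.X) ^ k * W α β ^ (2 * k + 1 - r))
      = ∑ n ∈ Finset.range (r + 1), (Nat.choose (2 * k + 1 - r) n : K)
      * (Nat.choose (k - n) (r - n) : K) * (β ^ n * α ^ (2 * k + 1 - r - n)) := by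
  obtain ⟨j, rfl⟩ := Nat.exists_eq_add_of_le hr
  have e : 2 * (r + j) + 1 - r = (r + j) + (j + 1) := by omega
  rw [e]
  have h : (1 - PowerSeries.X) ^ (r + j) * W α β ^ ((r + j) + (j + 1))
      = PowerSeries.X ^ ((r + j) + (j + 1)) *
        ((PowerSeries.X * PowerSeries.C β + PowerSeries.C α) ^ ((r + j) + (j + 1))
          * G K ^ (j + 1)) := by
    have := congrArg (· ^ (r + j)) (G_mul K)
    simp only [mul_pow, one_pow] at this
    rw [W, mul_pow, mul_pow, pow_add (G K), add_comm (PowerSeries.C α)]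
    linear_combination (PowerSeries.X ^ ((r + j) + (j + 1)) *
        ((PowerSeries.X * PowerSeries.C β + PowerSeries.C α) ^ ((r + j) + (j + 1))
          * G K ^ (j + 1))) * this
  have e2 : 2 * (r + j) + 1 = r + ((r + j) + (j + 1)) := by omega
  rw [h, e2, PowerSeries.coeff_X_pow_mul, add_pow, Finset.sum_mul, map_sum]
  have h2 : ∀ n ∈ Finset.range (r + j + (j + 1) + 1),
      PowerSeries.coeff r ((PowerSeries.X * PowerSeries.C β) ^ n
        * PowerSeries.C α ^ (r + j + (j + 1) - n)
        * ((r + j + (j + 1)).choose n : PowerSeries K) * G K ^ (j + 1))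
      = if n ≤ r then ((r + j + (j + 1)).choose n : K)
      * (Nat.choose (r + j - n) (r - n) : K) * (β ^ n * α ^ (r + j + (j + 1) - n)) else 0 := by
    intro n _
    have h3 : (PowerSeries.X * PowerSeries.C β) ^ n
        * PowerSeries.C α ^ (r + j + (j + 1) - n)
        * ((r + j + (j + 1)).choose n : PowerSeries K) * G K ^ (j + 1)
        = PowerSeries.X ^ n * (PowerSeries.C (((r + j + (j + 1)).choose n : K)
          * (β ^ n * α ^ (r + j + (j + 1) - n))) * G K ^ (j + 1)) := by
      simp only [map_mul, map_pow, map_natCast]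
      ring
    rw [h3, PowerSeries.coeff_X_pow_mul']
    split_ifs with hn
    · rw [PowerSeries.coeff_C_mul, G, PowerSeries.mk_one_pow_eq_mk_choose_add,
        PowerSeries.coeff_mk]
      have : (j + (r - n)).choose j = (r + j - n).choose (r - n) := by
        rw [show r + j - n = j + (r - n) by omega, Nat.choose_symm_add]
      rw [this]; ring
    · rfl
  rw [Finset.sum_congr rfl h2, ← Finset.sum_filter]
  apply Finset.sum_congr
  · ext n; simp; omega
  · intros; rfl

lemma coeff_S {K : Type*} [Field K] (k : ℕ) (α β : K) :
    PowerSeries.coeff (2 * k + 1) ((1 - PowerSeries.X) ^ k * S (2 * k + 1) (W α β))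
      = f k α β := by
  have hterm : ∀ m : ℕ, PowerSeries.coeff (2 * k + 1) ((1 - PowerSeries.X) ^ k *
      (PowerSeries.C (((m : K) + 1)⁻¹) * W α β ^ (m + 1))) = ((m : K) + 1)⁻¹ *
      PowerSeries.coeff (2 * k + 1) ((1 - PowerSeries.X) ^ k * W α β ^ (m + 1)) := by
    intro m
    rw [← PowerSeries.coeff_C_mul]; congr 1; ring
  rw [S, Finset.mul_sum, map_sum, Finset.sum_congr rfl fun m _ => hterm m,
    show 2 * k + 1 = k + (k + 1) by ring, Finset.sum_range_add,
    Finset.sum_eq_zero, zero_add, ← Finset.sum_range_reflect, f]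
  · apply Finset.sum_congr rfl
    intro r hr
    have hr : r ≤ k := by simpa [Nat.lt_succ_iff] using hr
    rw [show k + (k + 1 - 1 - r) + 1 = 2 * k + 1 - r by omega,
      show k + (k + 1) = 2 * k + 1 by ring, coeff_big k r hr, Finset.mul_sum]
    apply Finset.sum_congr rfl
    intro n _
    have : ((2 * k + 1 - r : ℕ) : K) = ((k + (k + 1 - 1 - r) : ℕ) : K) + 1 := by
      rw [show 2 * k + 1 - r = k + (k + 1 - 1 - r) + 1 by omega]; push_cast; rfl
    rw [this]; ring
  · intro m hm
    rw [show k + (k + 1) = 2 * k + 1 by ring, coeff_small k (m + 1) (by simpa using hm), mul_zero]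

lemma f_zero {K : Type*} [Field K] (k : ℕ) (β : K) : f k 0 β = 0 := by
  apply Finset.sum_eq_zero; intro r hr
  apply Finset.sum_eq_zero; intro n hn
  simp only [Finset.mem_range] at hr hn
  rw [zero_pow (by omega)]; simp

lemma one_sub_W {K : Type*} [Field K] (a b : K) : 1 - W (b - a) ((a - 1) * b)
    = (1 - PowerSeries.X * PowerSeries.C b)
      * (1 - PowerSeries.X + PowerSeries.X * PowerSeries.C a) * G K := by
  simp only [W, map_sub, map_mul, map_one]
  linear_combination -G_mul K

lemma W_dvd {K : Type*} [Field K] (α β : K) : PowerSeries.X ∣ W α β := Dvd.intro _ rfl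

lemma f_cyc {K : Type*} [Field K] [CharZero K] (k : ℕ) (a b c : K) :
    f k (b - a) ((a - 1) * b) + f k (c - b) ((b - 1) * c) + f k (a - c) ((c - 1) * a) = 0 := by
  have h := S_add3 (2 * k + 1) (W (b - a) ((a - 1) * b)) (W (c - b) ((b - 1) * c))
    (W (a - c) ((c - 1) * a)) (W (a - a) ((a - 1) * a)) (W (b - b) ((b - 1) * b))
    (W (c - c) ((c - 1) * c)) (W_dvd _ _) (W_dvd _ _) (W_dvd _ _) (W_dvd _ _) (W_dvd _ _)
    (W_dvd _ _) (by simp only [one_sub_W]; ring)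
  have h2 := (PowerSeries.X_pow_dvd_iff.mp (Dvd.dvd.mul_left h ((1 - PowerSeries.X) ^ k)))
    (2 * k + 1) (by omega)
  simp only [mul_sub, mul_add, map_sub, map_add] at h2
  simp only [coeff_S, sub_self] at h2
  simpa [f_zero, coeff_S] using h2

lemma term_eq {K : Type*} [Field K] (k r n : ℕ) (hr : r ≤ k) (hn : n ≤ r)
    (σ A B D P Q : K) (hσ : σ ≠ 0) (hA : A ≠ 0) (hB : B ≠ 0) :
    σ ^ (k - r) * (D ^ (2 * k + 1) * P ^ n * Q ^ (2 * k + 1 - r - n) * A ^ r * B ^ r)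
    = (A * B * D) ^ (2 * k + 1) * (σ ^ (k + 1))⁻¹ *
      ((σ * P / (A * B)) ^ n * (σ * Q / (A * B)) ^ (2 * k + 1 - r - n)) := by
  obtain ⟨i, rfl⟩ := Nat.exists_eq_add_of_le hn
  obtain ⟨j, rfl⟩ := Nat.exists_eq_add_of_le hr
  rw [show n + i + j - (n + i) = j by omega,
    show 2 * (n + i + j) + 1 - (n + i) - n = i + 2 * j + 1 by omega]
  simp only [div_pow, mul_pow]
  field_simp
  ring

lemma main {K : Type*} [Field K] [CharZero K] (k : ℕ) (s t u v w x y z : K)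
    (hs : s ≠ 0) (ht : t ≠ 0) (hA : u * t - x * s ≠ 0) (hB : v * t - y * s ≠ 0)
    (hD : w * t - z * s ≠ 0) (g : K) (c : ℕ → K)
    (hc : ∀ r ≤ k, c r = g * ((2 * k + 1 - r : ℕ) : K)⁻¹) :
    ∑ r ∈ Finset.range (k + 1), ∑ n ∈ Finset.range (r + 1),
        (c r * (Nat.choose (2 * k + 1 - r) n : K) * (Nat.choose (k - n) (r - n) : K)) *
          (s * t) ^ (k - r) *
          ((u * t - x * s) ^ (2 * k + 1) * (w * y) ^ n
              * (v * z - w * y) ^ (2 * k + 1 - r - n)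
              * (v * t - y * s) ^ r * (w * t - z * s) ^ r
            + (v * t - y * s) ^ (2 * k + 1) * (u * z) ^ n
              * (w * x - u * z) ^ (2 * k + 1 - r - n)
              * (w * t - z * s) ^ r * (u * t - x * s) ^ r
            + (w * t - z * s) ^ (2 * k + 1) * (v * x) ^ n
              * (u * y - v * x) ^ (2 * k + 1 - r - n)
              * (u * t - x * s) ^ r * (v * t - y * s) ^ r) = 0 := by
  have hα : ∀ u x v y : K, u * t - x * s ≠ 0 → v * t - y * s ≠ 0 →
      v * t / (v * t - y * s) - u * t / (u * t - x * s)
        = (s * t) * (u * y - v * x) / ((u * t - x * s) * (v * t - y * s)) := by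
    intro u x v y h1 h2
    rw [div_sub_div _ _ h2 h1, div_eq_div_iff (mul_ne_zero h2 h1) (mul_ne_zero h1 h2)]
    ring
  have hβ : ∀ u x v y : K, u * t - x * s ≠ 0 → v * t - y * s ≠ 0 →
      (u * t / (u * t - x * s) - 1) * (v * t / (v * t - y * s))
        = (s * t) * (v * x) / ((u * t - x * s) * (v * t - y * s)) := by
    intro u x v y h1 h2
    rw [div_sub_one h1, div_mul_div_comm]
    congr 1; ring
  have key := f_cyc k (u * t / (u * t - x * s)) (v * t / (v * t - y * s))
    (w * t / (w * t - z * s))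
  rw [hα u x v y hA hB, hα v y w z hB hD, hα w z u x hD hA,
    hβ u x v y hA hB, hβ v y w z hB hD, hβ w z u x hD hA] at key
  set A := u * t - x * s
  set B := v * t - y * s
  set D := w * t - z * s
  have hσ : s * t ≠ 0 := mul_ne_zero hs ht
  have : ∀ F : K, F = g * ((A * B * D) ^ (2 * k + 1) * ((s * t) ^ (k + 1))⁻¹) * 0 → F = 0 := by
    intro F h; simpa using h
  apply this
  rw [← key]
  simp only [f, ← Finset.sum_add_distrib, Finset.mul_sum]
  apply Finset.sum_congr rfl; intro r hr
  apply Finset.sum_congr rfl; intro n hn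
  have hr : r ≤ k := by simpa [Nat.lt_succ_iff] using hr
  have hn : n ≤ r := by simpa [Nat.lt_succ_iff] using hn
  have t1 := term_eq k r n hr hn (s * t) A B D (v * x) (u * y - v * x) hσ hA hB
  have t2 := term_eq k r n hr hn (s * t) B D A (w * y) (v * z - w * y) hσ hB hD
  have t3 := term_eq k r n hr hn (s * t) D A B (u * z) (w * x - u * z) hσ hD hA
  rw [show B * D * A = A * B * D by ring] at t2
  rw [show D * A * B = A * B * D by ring] at t3
  rw [hc r hr]
  linear_combination (g * ((2 * k + 1 - r : ℕ) : K)⁻¹ * (Nat.choose (2 * k + 1 - r) n : K)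
    * (Nat.choose (k - n) (r - n) : K)) * (t1 + t2 + t3)

lemma ne_aux (i j : Fin 8) (hi : i ≠ 0 ∧ i ≠ 1) (hj : j ≠ i ∧ j ≠ 1) :
    (X i * X 1 - X j * X 0 : MvPolynomial (Fin 8) ℤ) ≠ 0 := by
  intro h
  have := congrArg (MvPolynomial.eval (fun l => if l = i ∨ l = 1 then (1 : ℤ) else 0)) h
  simp [hj.1, hj.2, hi.1.symm] at this

lemma transfer (K : Type*) [Field K] (φ : MvPolynomial (Fin 8) ℤ →+* K)
    (hφ : Function.Injective φ) (q k : ℕ) (hq1 : q = k + 1) (d : ℤ) (c : ℕ → ℤ)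
    (hc : ∀ r : ℕ, r ≤ k → (2 * (q : ℤ) - 1 - r) * c r = d * q) :
    let R := MvPolynomial (Fin 8) ℤ
    let s : R := X 0; let t : R := X 1; let u : R := X 2; let v : R := X 3
    let w : R := X 4; let x : R := X 5; let y : R := X 6; let z : R := X 7
    ∑ r ∈ Finset.range (k + 1), ∑ n ∈ Finset.range (r + 1),
        C (c r * (Nat.choose (2 * k + 1 - r) n : ℤ) * (Nat.choose (k - n) (r - n) : ℤ)) *
          (s * t) ^ (k - r) *
          ((u * t - x * s) ^ (2 * k + 1) * (w * y) ^ n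
              * (v * z - w * y) ^ (2 * k + 1 - r - n)
              * (v * t - y * s) ^ r * (w * t - z * s) ^ r
            + (v * t - y * s) ^ (2 * k + 1) * (u * z) ^ n
              * (w * x - u * z) ^ (2 * k + 1 - r - n)
              * (w * t - z * s) ^ r * (u * t - x * s) ^ r
            + (w * t - z * s) ^ (2 * k + 1) * (v * x) ^ n
              * (u * y - v * x) ^ (2 * k + 1 - r - n)
              * (u * t - x * s) ^ r * (v * t - y * s) ^ r) = 0 := by
  intro R s t u v w x y z
  have h0 : ∀ a : MvPolynomial (Fin 8) ℤ, a ≠ 0 → φ a ≠ 0 := fun a ha => by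
    rw [← map_zero φ]; exact fun h => ha (hφ h)
  have : CharZero K := ⟨fun a b hab => by
    have : φ (a : MvPolynomial (Fin 8) ℤ) = φ (b : MvPolynomial (Fin 8) ℤ) := by
      simpa only [map_natCast] using hab
    exact_mod_cast hφ this⟩
  apply hφ
  rw [map_zero]
  have m := main k (φ s) (φ t) (φ u) (φ v) (φ w) (φ x) (φ y) (φ z)
    (h0 _ (X_ne_zero 0)) (h0 _ (X_ne_zero 1))
    (by simpa only [map_sub, map_mul] using h0 _ (ne_aux 2 5 (by decide) (by decide)))
    (by simpa only [map_sub, map_mul] using h0 _ (ne_aux 3 6 (by decide) (by decide)))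
    (by simpa only [map_sub, map_mul] using h0 _ (ne_aux 4 7 (by decide) (by decide)))
    ((d : K) * (q : K)) (fun r => ((c r : ℤ) : K)) (by
      intro r hr
      have h1 := hc r hr
      have h2 : (2 * (q : ℤ) - 1 - r) = ((2 * k + 1 - r : ℕ) : ℤ) := by
        rw [hq1]; push_cast [show r ≤ 2 * k + 1 by omega]; ring
      rw [h2] at h1
      have h3 : ((2 * k + 1 - r : ℕ) : K) ≠ 0 := by
        rw [Nat.cast_ne_zero]; omega
      rw [eq_mul_inv_iff_mul_eq₀ h3, mul_comm]
      simpa only [Int.cast_mul, Int.cast_natCast] using congrArg (Int.cast : ℤ → K) h1)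
  rw [← m]
  have hC : ∀ a : ℤ, φ (C a) = (a : K) := fun a => by
    rw [← map_intCast φ, ← map_intCast (C : ℤ →+* MvPolynomial (Fin 8) ℤ)]; simp
  simp only [R, map_sum, map_mul, map_add, map_sub, map_pow, hC, Int.cast_natCast]

end Aux16

theorem stmt_16 (p : ℕ) (hp : p.Prime) (e : ℕ) (he : 1 ≤ e) (q : ℕ) (hq : q = p ^ e)
    (k : ℕ) (hk : k = q - 1) (d : ℤ) (hd : d ≡ 1 [ZMOD p]) (c : ℕ → ℤ)
    (hc : ∀ r : ℕ, r ≤ k → (2 * (q : ℤ) - 1 - r) * c r = d * q) :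
    let R := MvPolynomial (Fin 8) ℤ
    let s : R := X 0; let t : R := X 1; let u : R := X 2; let v : R := X 3
    let w : R := X 4; let x : R := X 5; let y : R := X 6; let z : R := X 7
    ∑ r ∈ Finset.range (k + 1), ∑ n ∈ Finset.range (r + 1),
        C (c r * (Nat.choose (2 * k + 1 - r) n : ℤ) * (Nat.choose (k - n) (r - n) : ℤ)) *
          (s * t) ^ (k - r) *
          ((u * t - x * s) ^ (2 * k + 1) * (w * y) ^ n
              * (v * z - w * y) ^ (2 * k + 1 - r - n)
              * (v * t - y * s) ^ r * (w * t - z * s) ^ r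
            + (v * t - y * s) ^ (2 * k + 1) * (u * z) ^ n
              * (w * x - u * z) ^ (2 * k + 1 - r - n)
              * (w * t - z * s) ^ r * (u * t - x * s) ^ r
            + (w * t - z * s) ^ (2 * k + 1) * (v * x) ^ n
              * (u * y - v * x) ^ (2 * k + 1 - r - n)
              * (u * t - x * s) ^ r * (v * t - y * s) ^ r) = 0 := by
  intro R s t u v w x y z
  have hq1 : q = k + 1 := by
    have : 0 < q := by rw [hq]; exact pow_pos hp.pos e
    omega
  have h := Aux16.transfer (FractionRing (MvPolynomial (Fin 8) ℤ))
    (algebraMap (MvPolynomial (Fin 8) ℤ) _) (IsFractionRing.injective _ _) q k hq1 d c hc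
  exact h
end

section
/- Let R = ℤ[u,v,w,x,y,z], Δ₁ = vz-wy, Δ₂ = wx-uz, Δ₃ = uy-vx. For every natural number k the following identity holds in R: ∑ over the three cyclic terms of Δ₁^{2k+1}·u^{k+1}·∑_{n=0}^{k} C(k,n)·x^n·∑_{i=0}^{n} (-1)^i·C(k+i,k)·C(k+n-i,k)·w^i·v^{n-i}·Δ₂^{k-i}·Δ₃^{k-n+i} (plus the two terms obtained by cyclically permuting (u,x,Δ₁) → (v,y,Δ₂) → (w,z,Δ₃)) equals 0. -/
open MvPolynomial

section Aux

variable {K : Type*} [Field K]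

/-- The expansion of `(1 - c t)^{-(k+1)}`. -/
noncomputable def geomPow (k : ℕ) (c : K) : PowerSeries K :=
  PowerSeries.mk fun n => c ^ n * (Nat.choose (k + n) k : K)

lemma geomPow_mul (k : ℕ) (c : K) :
    geomPow k c * (1 - PowerSeries.C c * PowerSeries.X) ^ (k + 1) = 1 := by
  have h := congrArg (PowerSeries.rescale c) (PowerSeries.mk_add_choose_mul_one_sub_pow_eq_one K k)
  rw [map_mul, PowerSeries.rescale_mk, map_pow, map_sub, map_one, PowerSeries.rescale_X] at h
  exact h

/-- The inner double sum. -/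
def innerSum (k : ℕ) (v w x d₂ d₃ : K) : K :=
  ∑ n ∈ Finset.range (k + 1), (Nat.choose k n : K) * x ^ n *
    ∑ i ∈ Finset.range (n + 1), (-1 : K) ^ i * (Nat.choose (k + i) k : K)
      * (Nat.choose (k + n - i) k : K) * w ^ i * v ^ (n - i)
      * d₂ ^ (k - i) * d₃ ^ (k - n + i)

lemma innerSum_eq (k : ℕ) (v w x d₂ d₃ : K) (h₂ : d₂ ≠ 0) (h₃ : d₃ ≠ 0) :
    innerSum k v w x d₂ d₃ = (d₂ * d₃) ^ k * PowerSeries.coeff k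
      ((PowerSeries.X + PowerSeries.C x) ^ k * (geomPow k (-w / d₂) * geomPow k (v / d₃))) := by
  rw [add_comm PowerSeries.X, add_pow, Finset.sum_mul, map_sum, Finset.mul_sum, innerSum]
  refine Finset.sum_congr rfl fun n hn => ?_
  have hnk : n ≤ k := by simpa [Nat.lt_succ_iff] using hn
  have e : (PowerSeries.C x ^ n * PowerSeries.X ^ (k - n) * (Nat.choose k n : PowerSeries K)
        * (geomPow k (-w / d₂) * geomPow k (v / d₃)))
      = PowerSeries.C ((Nat.choose k n : K) * x ^ n) *
        (PowerSeries.X ^ (k - n) * (geomPow k (-w / d₂) * geomPow k (v / d₃))) := by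
    rw [map_mul, map_pow, map_natCast]; ring
  rw [e, PowerSeries.coeff_C_mul, PowerSeries.coeff_X_pow_mul', if_pos (Nat.sub_le _ _),
    Nat.sub_sub_self hnk, PowerSeries.coeff_mul,
    Finset.Nat.sum_antidiagonal_eq_sum_range_succ_mk,
    mul_left_comm ((d₂ * d₃) ^ k), Finset.mul_sum _ _ ((d₂ * d₃) ^ k)]
  congr 1
  refine Finset.sum_congr rfl fun i hi => ?_
  have hin : i ≤ n := by simpa [Nat.lt_succ_iff] using hi
  simp only [geomPow, PowerSeries.coeff_mk]
  obtain ⟨j, rfl⟩ := Nat.exists_eq_add_of_le hin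
  obtain ⟨l, rfl⟩ := Nat.exists_eq_add_of_le hnk
  have e1 : i + j + l + (i + j) - i = i + j + l + j := by omega
  have e2 : i + j + l - i = j + l := by omega
  have e3 : i + j + l - (i + j) + i = l + i := by omega
  have e4 : i + j - i = j := by omega
  rw [e1, e2, e3, e4, div_pow, div_pow, neg_pow w, mul_pow]
  field_simp
  ring

lemma coeff_comp_lin (k : ℕ) (A : Polynomial K) (hA : A.natDegree ≤ k) (a b : K) (ha : a ≠ 0) :
    (A.comp (Polynomial.C a * Polynomial.X + Polynomial.C b)).coeff k = A.coeff k * a ^ k := by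
  have hd : (Polynomial.C a * Polynomial.X + Polynomial.C b).natDegree = 1 :=
    Polynomial.natDegree_linear ha
  rcases hA.eq_or_lt with h | h
  · have := Polynomial.coeff_comp_degree_mul_degree (p := A)
      (q := Polynomial.C a * Polynomial.X + Polynomial.C b) (by rw [hd]; simp)
    rw [hd, mul_one, h, Polynomial.leadingCoeff_linear ha, Polynomial.leadingCoeff, h] at this
    exact this
  · rw [Polynomial.coeff_eq_zero_of_natDegree_lt h, zero_mul]
    apply Polynomial.coeff_eq_zero_of_natDegree_lt
    rw [Polynomial.natDegree_comp, hd, mul_one]; exact h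

/-- The linear form `u r - x`. -/
noncomputable def lin (u x : K) : Polynomial K := Polynomial.C u * Polynomial.X + Polynomial.C (-x)

lemma term_eq (k : ℕ) (u v w x y z : K) (hu : u ≠ 0) (h₂ : w * x - u * z ≠ 0)
    (h₃ : u * y - v * x ≠ 0) (A D : Polynomial K) (hA : A.natDegree ≤ k)
    (h : Polynomial.X ^ k = A * (lin v y ^ (k + 1) * lin w z ^ (k + 1)) + lin u x ^ (k + 1) * D) :
    u ^ (2 * k + 2) * innerSum k v w x (w * x - u * z) (u * y - v * x) =
      ((w * x - u * z) * (u * y - v * x)) ^ (2 * k + 1) * (-1) ^ (k + 1) * A.coeff k := by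
  set d₂ := w * x - u * z with hd₂
  set d₃ := u * y - v * x with hd₃
  rw [innerSum_eq k v w x d₂ d₃ h₂ h₃]
  set q : Polynomial K := Polynomial.C u⁻¹ * Polynomial.X + Polynomial.C (x * u⁻¹) with hq
  have hcu : Polynomial.C u * Polynomial.C u⁻¹ = (1 : Polynomial K) := by
    rw [← Polynomial.C_mul, mul_inv_cancel₀ hu, Polynomial.C_1]
  have h' := congrArg (fun p : Polynomial K => ((p.comp q : Polynomial K) : PowerSeries K)) h
  have c1 : (((lin u x).comp q : Polynomial K) : PowerSeries K) = PowerSeries.X := by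
    have : (lin u x).comp q = Polynomial.X := by
      simp only [lin, hq, Polynomial.add_comp, Polynomial.mul_comp, Polynomial.C_comp,
        Polynomial.X_comp, Polynomial.neg_comp, map_mul, map_neg]
      linear_combination (Polynomial.X + Polynomial.C x) * hcu
    rw [this, Polynomial.coe_X]
  have c2 : (((lin v y).comp q : Polynomial K) : PowerSeries K)
      = PowerSeries.C (-(d₃ / u)) * (1 - PowerSeries.C (v / d₃) * PowerSeries.X) := by
    have : (lin v y).comp q
        = Polynomial.C (-(d₃ / u)) * (1 - Polynomial.C (v / d₃) * Polynomial.X) := by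
      have e1 : v * u⁻¹ = d₃ / u * (v / d₃) := by field_simp
      have e2 : v * (x * u⁻¹) - y = -(d₃ / u) := by rw [hd₃]; field_simp; ring
      have e1' := congrArg Polynomial.C e1
      have e2' := congrArg Polynomial.C e2
      simp only [map_mul, map_sub, map_neg] at e1' e2'
      simp only [lin, hq, Polynomial.add_comp, Polynomial.mul_comp, Polynomial.C_comp,
        Polynomial.X_comp, Polynomial.neg_comp, map_mul, map_neg]
      linear_combination Polynomial.X * e1' + e2'
    rw [this]; simp
  have c3 : (((lin w z).comp q : Polynomial K) : PowerSeries K)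
      = PowerSeries.C (d₂ / u) * (1 - PowerSeries.C (-w / d₂) * PowerSeries.X) := by
    have : (lin w z).comp q
        = Polynomial.C (d₂ / u) * (1 - Polynomial.C (-w / d₂) * Polynomial.X) := by
      have e1 : w * u⁻¹ = -(d₂ / u * (-w / d₂)) := by field_simp
      have e2 : w * (x * u⁻¹) - z = d₂ / u := by rw [hd₂]; field_simp
      have e1' := congrArg Polynomial.C e1
      have e2' := congrArg Polynomial.C e2
      simp only [map_mul, map_sub, map_neg] at e1' e2'
      simp only [lin, hq, Polynomial.add_comp, Polynomial.mul_comp, Polynomial.C_comp,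
        Polynomial.X_comp, Polynomial.neg_comp, map_mul, map_neg]
      linear_combination Polynomial.X * e1' + e2'
    rw [this]; simp
  have c0 : ((q : Polynomial K) : PowerSeries K)
      = PowerSeries.C u⁻¹ * (PowerSeries.X + PowerSeries.C x) := by
    rw [hq]; simp; ring
  simp only [Polynomial.add_comp, Polynomial.mul_comp, Polynomial.pow_comp, Polynomial.X_comp,
    Polynomial.coe_add, Polynomial.coe_mul, Polynomial.coe_pow, c0, c1, c2, c3] at h'
  set G := geomPow k (-w / d₂) with hG
  set H := geomPow k (v / d₃) with hH
  have g1 := geomPow_mul k (-w / d₂)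
  have g2 := geomPow_mul k (v / d₃)
  rw [← hG] at g1
  rw [← hH] at g2
  set Y := (1 - PowerSeries.C (-w / d₂) * PowerSeries.X) ^ (k + 1) with hY
  set Z := (1 - PowerSeries.C (v / d₃) * PowerSeries.X) ^ (k + 1) with hZ
  have key : PowerSeries.C (u⁻¹ ^ k) * ((PowerSeries.X + PowerSeries.C x) ^ k * (G * H))
      = PowerSeries.C ((-(d₃ / u)) ^ (k + 1) * (d₂ / u) ^ (k + 1)) *
          ((A.comp q : Polynomial K) : PowerSeries K)
        + PowerSeries.X ^ (k + 1) * (((D.comp q : Polynomial K) : PowerSeries K) * (G * H)) := by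
    simp only [mul_pow, ← map_pow, ← hY, ← hZ] at h'
    simp only [map_mul]
    set a := PowerSeries.C ((-(d₃ / u)) ^ (k + 1))
    set b := PowerSeries.C ((d₂ / u) ^ (k + 1))
    set Aq := ((A.comp q : Polynomial K) : PowerSeries K)
    linear_combination (G * H) * h' + a * b * Aq * (H * Z) * g1 + a * b * Aq * g2
  have key2 := congrArg (PowerSeries.coeff k) key
  rw [map_add, PowerSeries.coeff_C_mul, PowerSeries.coeff_C_mul, PowerSeries.coeff_X_pow_mul',
    if_neg (by omega), add_zero, Polynomial.coeff_coe, hq,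
    coeff_comp_lin k A hA _ _ (inv_ne_zero hu)] at key2
  set T := PowerSeries.coeff k ((PowerSeries.X + PowerSeries.C x) ^ k * (G * H))
  have key3 : T = (-(d₃ / u)) ^ (k + 1) * (d₂ / u) ^ (k + 1) * A.coeff k := by
    have hne : u⁻¹ ^ k ≠ 0 := pow_ne_zero _ (inv_ne_zero hu)
    apply mul_left_cancel₀ hne
    linear_combination key2
  rw [key3, neg_pow, div_pow, div_pow]
  have : u ^ (2 * k + 2) = u ^ (k + 1) * u ^ (k + 1) := by ring
  rw [this]
  field_simp
  ring

lemma lin_coprime (u v x y : K) (h : u * y - v * x ≠ 0) : IsCoprime (lin u x) (lin v y) := by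
  refine ⟨Polynomial.C (v * (u * y - v * x)⁻¹), Polynomial.C (-u * (u * y - v * x)⁻¹), ?_⟩
  have e : Polynomial.C ((u * y - v * x) * (u * y - v * x)⁻¹) = (1 : Polynomial K) := by
    rw [mul_inv_cancel₀ h, Polynomial.C_1]
  simp only [lin, map_mul, map_neg, map_sub] at e ⊢
  linear_combination e

lemma lin_natDegree (u x : K) (hu : u ≠ 0) : (lin u x).natDegree = 1 :=
  Polynomial.natDegree_linear hu

lemma lin_ne (u x : K) (hu : u ≠ 0) : lin u x ≠ 0 := by
  intro h
  have := lin_natDegree u x hu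
  rw [h] at this
  simp at this

lemma lin_pow_natDegree (u x : K) (hu : u ≠ 0) (m : ℕ) : (lin u x ^ m).natDegree = m := by
  rw [Polynomial.natDegree_pow, lin_natDegree u x hu, mul_one]

lemma lin_pow_coeff (u x : K) (hu : u ≠ 0) (m : ℕ) : (lin u x ^ m).coeff m = u ^ m := by
  have := Polynomial.coeff_pow_of_natDegree_le (p := lin u x) (n := 1) (m := m)
    (lin_natDegree u x hu).le
  rw [mul_one] at this
  rw [this]
  simp [lin]

lemma exists_rem (k : ℕ) (f p q : Polynomial K) (hp : p.natDegree = k + 1)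
    (h : IsCoprime p q) : ∃ A D : Polynomial K, A.natDegree ≤ k ∧ f = A * q + p * D := by
  obtain ⟨a, b, hab⟩ := h
  have hp0 : p ≠ 0 := by rintro rfl; simp at hp
  refine ⟨(f * b) % p, f * a + (f * b) / p * q, ?_, ?_⟩
  · have := Polynomial.natDegree_mod_lt (f * b) (q := p) (by omega)
    omega
  · have := EuclideanDomain.div_add_mod (f * b) p
    linear_combination -q * this - f * hab

lemma top_coeff (k : ℕ) (A : Polynomial K) (hA : A.natDegree ≤ k) (v y w z : K)
    (hv : v ≠ 0) (hw : w ≠ 0) :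
    (A * (lin v y ^ (k + 1) * lin w z ^ (k + 1))).natDegree ≤ 3 * k + 2 ∧
    (A * (lin v y ^ (k + 1) * lin w z ^ (k + 1))).coeff (3 * k + 2)
      = A.coeff k * (v ^ (k + 1) * w ^ (k + 1)) := by
  have h1 := lin_pow_natDegree v y hv (k + 1)
  have h2 := lin_pow_natDegree w z hw (k + 1)
  have h3 : (lin v y ^ (k + 1) * lin w z ^ (k + 1)).natDegree ≤ (k + 1) + (k + 1) :=
    Polynomial.natDegree_mul_le_of_le h1.le h2.le
  constructor
  · exact (Polynomial.natDegree_mul_le_of_le hA h3).trans (by omega)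
  · have e : 3 * k + 2 = k + ((k + 1) + (k + 1)) := by ring
    rw [e, Polynomial.coeff_mul_add_eq_of_natDegree_le hA h3,
      Polynomial.coeff_mul_add_eq_of_natDegree_le h1.le h2.le,
      lin_pow_coeff _ _ hv, lin_pow_coeff _ _ hw]

lemma field_identity (k : ℕ) (u v w x y z : K) (hu : u ≠ 0) (hv : v ≠ 0) (hw : w ≠ 0)
    (h₁ : v * z - w * y ≠ 0) (h₂ : w * x - u * z ≠ 0) (h₃ : u * y - v * x ≠ 0) :
    (v * z - w * y) ^ (2 * k + 1) * u ^ (k + 1) *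
        innerSum k v w x (w * x - u * z) (u * y - v * x)
      + (w * x - u * z) ^ (2 * k + 1) * v ^ (k + 1) *
        innerSum k w u y (u * y - v * x) (v * z - w * y)
      + (u * y - v * x) ^ (2 * k + 1) * w ^ (k + 1) *
        innerSum k u v z (v * z - w * y) (w * x - u * z) = 0 := by
  have c12 : IsCoprime (lin u x ^ (k + 1)) (lin v y ^ (k + 1)) := (lin_coprime _ _ _ _ h₃).pow
  have c23 : IsCoprime (lin v y ^ (k + 1)) (lin w z ^ (k + 1)) := (lin_coprime _ _ _ _ h₁).pow
  have c31 : IsCoprime (lin w z ^ (k + 1)) (lin u x ^ (k + 1)) := (lin_coprime _ _ _ _ h₂).pow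
  obtain ⟨A, D, hA, eA⟩ := exists_rem k (Polynomial.X ^ k) _ _
    (lin_pow_natDegree u x hu (k + 1)) (c12.mul_right c31.symm)
  obtain ⟨B, E, hB, eB⟩ := exists_rem k (Polynomial.X ^ k) _ _
    (lin_pow_natDegree v y hv (k + 1)) (c23.mul_right c12.symm)
  obtain ⟨C, F, hC, eC⟩ := exists_rem k (Polynomial.X ^ k) _ _
    (lin_pow_natDegree w z hw (k + 1)) (c31.mul_right c23.symm)
  have t1 := term_eq k u v w x y z hu h₂ h₃ A D hA eA
  have t2 := term_eq k v w u y z x hv h₃ h₁ B E hB eB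
  have t3 := term_eq k w u v z x y hw h₁ h₂ C F hC eC
  obtain ⟨n1, l1⟩ := top_coeff k A hA v y w z hv hw
  obtain ⟨n2, l2⟩ := top_coeff k B hB w z u x hw hu
  obtain ⟨n3, l3⟩ := top_coeff k C hC u x v y hu hv
  have hk : (Polynomial.X ^ k : Polynomial K).natDegree ≤ 3 * k + 2 := by
    rw [Polynomial.natDegree_X_pow]; omega
  have hkc : (Polynomial.X ^ k : Polynomial K).coeff (3 * k + 2) = 0 := by
    rw [Polynomial.coeff_X_pow, if_neg (by omega)]
  set a := lin u x ^ (k + 1) with ha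
  set b := lin v y ^ (k + 1) with hb
  set c := lin w z ^ (k + 1) with hc
  have hz : Polynomial.X ^ k - A * (b * c) - B * (c * a) - C * (a * b) = 0 := by
    have hdvd : a * b * c ∣ Polynomial.X ^ k - A * (b * c) - B * (c * a) - C * (a * b) := by
      refine IsCoprime.mul_dvd (c31.symm.mul_left c23) (IsCoprime.mul_dvd c12 ?_ ?_) ?_
      · exact ⟨D - B * c - C * b, by linear_combination eA⟩
      · exact ⟨E - A * c - C * a, by linear_combination eB⟩
      · exact ⟨F - A * b - B * a, by linear_combination eC⟩
    refine Polynomial.eq_zero_of_dvd_of_natDegree_lt hdvd ?_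
    have ne1 : a ≠ 0 := pow_ne_zero _ (lin_ne _ _ hu)
    have ne2 : b ≠ 0 := pow_ne_zero _ (lin_ne _ _ hv)
    have ne3 : c ≠ 0 := pow_ne_zero _ (lin_ne _ _ hw)
    rw [Polynomial.natDegree_mul (mul_ne_zero ne1 ne2) ne3, Polynomial.natDegree_mul ne1 ne2,
      ha, hb, hc, lin_pow_natDegree _ _ hu, lin_pow_natDegree _ _ hv, lin_pow_natDegree _ _ hw,
      ← ha, ← hb, ← hc]
    have := Polynomial.natDegree_sub_le_of_le (Polynomial.natDegree_sub_le_of_le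
      (Polynomial.natDegree_sub_le_of_le hk n1) n2) n3
    simp only [max_self] at this
    omega
  have hco := congrArg (fun p => Polynomial.coeff p (3 * k + 2)) hz
  simp only [Polynomial.coeff_sub, l1, l2, l3, hkc, Polynomial.coeff_zero] at hco
  set I₁ := innerSum k v w x (w * x - u * z) (u * y - v * x)
  set I₂ := innerSum k w u y (u * y - v * x) (v * z - w * y)
  set I₃ := innerSum k u v z (v * z - w * y) (w * x - u * z)
  generalize v * z - w * y = d₁ at *
  generalize w * x - u * z = d₂ at *
  generalize u * y - v * x = d₃ at *
  have hne : (u * v * w) ^ (k + 1) ≠ 0 := pow_ne_zero _ (mul_ne_zero (mul_ne_zero hu hv) hw)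
  apply mul_left_cancel₀ hne
  rw [mul_zero]
  have e : ∀ s : K, s ^ (2 * k + 2) = s ^ (k + 1) * s ^ (k + 1) := fun s => by ring
  rw [e, mul_pow] at t1 t2 t3
  rw [mul_pow, mul_pow]
  generalize u ^ (k + 1) = U at *
  generalize v ^ (k + 1) = V at *
  generalize w ^ (k + 1) = W at *
  generalize d₁ ^ (2 * k + 1) = P at *
  generalize d₂ ^ (2 * k + 1) = Q at *
  generalize d₃ ^ (2 * k + 1) = S at *
  linear_combination P * V * W * t1 + Q * W * U * t2 + S * U * V * t3
    - P * Q * S * (-1) ^ (k + 1) * hco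

end Aux

theorem stmt_18 (k : ℕ) :
    let R := MvPolynomial (Fin 6) ℤ
    let u : R := X 0; let v : R := X 1; let w : R := X 2
    let x : R := X 3; let y : R := X 4; let z : R := X 5
    let Δ₁ : R := v * z - w * y
    let Δ₂ : R := w * x - u * z
    let Δ₃ : R := u * y - v * x
    Δ₁ ^ (2 * k + 1) * u ^ (k + 1) *
        (∑ n ∈ Finset.range (k + 1), (Nat.choose k n : R) * x ^ n *
          ∑ i ∈ Finset.range (n + 1), (-1 : R) ^ i * (Nat.choose (k + i) k : R)
            * (Nat.choose (k + n - i) k : R) * w ^ i * v ^ (n - i)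
            * Δ₂ ^ (k - i) * Δ₃ ^ (k - n + i))
      + Δ₂ ^ (2 * k + 1) * v ^ (k + 1) *
        (∑ n ∈ Finset.range (k + 1), (Nat.choose k n : R) * y ^ n *
          ∑ i ∈ Finset.range (n + 1), (-1 : R) ^ i * (Nat.choose (k + i) k : R)
            * (Nat.choose (k + n - i) k : R) * u ^ i * w ^ (n - i)
            * Δ₃ ^ (k - i) * Δ₁ ^ (k - n + i))
      + Δ₃ ^ (2 * k + 1) * w ^ (k + 1) *
        (∑ n ∈ Finset.range (k + 1), (Nat.choose k n : R) * z ^ n *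
          ∑ i ∈ Finset.range (n + 1), (-1 : R) ^ i * (Nat.choose (k + i) k : R)
            * (Nat.choose (k + n - i) k : R) * v ^ i * u ^ (n - i)
            * Δ₁ ^ (k - i) * Δ₂ ^ (k - n + i))
      = 0 := by
  intro R u v w x y z Δ₁ Δ₂ Δ₃
  have ev : ∀ (p : R) (f : Fin 6 → ℤ), MvPolynomial.eval f p ≠ 0 → p ≠ 0 := by
    rintro p f h rfl
    exact h (map_zero _)
  have hu : u ≠ 0 := MvPolynomial.X_ne_zero _
  have hv : v ≠ 0 := MvPolynomial.X_ne_zero _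
  have hw : w ≠ 0 := MvPolynomial.X_ne_zero _
  have h₁ : v * z - w * y ≠ 0 := ev _ ![0, 1, 0, 0, 0, 1] (by simp [u, v, w, x, y, z])
  have h₂ : w * x - u * z ≠ 0 := ev _ ![0, 0, 1, 1, 0, 0] (by simp [u, v, w, x, y, z])
  have h₃ : u * y - v * x ≠ 0 := ev _ ![1, 0, 0, 0, 1, 0] (by simp [u, v, w, x, y, z])
  have inj : Function.Injective (algebraMap R (FractionRing R)) :=
    IsFractionRing.injective R (FractionRing R)
  have nz : ∀ p : R, p ≠ 0 → algebraMap R (FractionRing R) p ≠ 0 := fun p hp h =>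
    hp (inj (by rw [h, map_zero]))
  have main := field_identity k (algebraMap R (FractionRing R) u) (algebraMap R (FractionRing R) v)
    (algebraMap R (FractionRing R) w) (algebraMap R (FractionRing R) x)
    (algebraMap R (FractionRing R) y) (algebraMap R (FractionRing R) z)
    (nz _ hu) (nz _ hv) (nz _ hw)
    (by simpa only [map_sub, map_mul] using nz _ h₁)
    (by simpa only [map_sub, map_mul] using nz _ h₂)
    (by simpa only [map_sub, map_mul] using nz _ h₃)
  apply inj
  simp only [innerSum] at main
  simp only [map_add, map_mul, map_pow, map_sum, map_natCast, map_neg, map_one, map_zero, Δ₁, Δ₂,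
    Δ₃, map_sub]
  exact main
end
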